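/- Let F be a finite field and let Q be a quadratic form on F⁸ whose polar form B(u,v) = Q(u+v) − Q(u) − Q(v) is nondegenerate and which has a totally singular subspace of dimension 3 but no totally singular subspace of dimension 4 (i.e., Q is of minus type, Witt index 3). Let O(Q) be the group of F-linear automorphisms g of F⁸ with Q(g(v)) = Q(v) for all v, and let Ω₈⁻(q) be the derived subgroup of O(Q), where q = |F|. Then Ω₈⁻(q) is (2,3)-generated for every prime power q ≥ 2. -/

import Mathlib

open Matrix

/-- A group is `(2,3)`-generated if it is generated by an element of order 2
together with an element of order 3. -/
def IsTwoThreeGenerated (G : Type*) [Group G] : Prop :=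
  ∃ x y : G, orderOf x = 2 ∧ orderOf y = 3 ∧ Subgroup.closure {x, y} = ⊤

/-- The plus-type quadratic form `Q⁺(v) = v₁v₅ + v₂v₆ + v₃v₇ + v₄v₈` on `F⁸`. -/
def QPlus (F : Type*) [Field F] (v : Fin 8 → F) : F :=
  v 0 * v 4 + v 1 * v 5 + v 2 * v 6 + v 3 * v 7

/-- The group of linear automorphisms of `F⁸` preserving the form `Q`,
as a subgroup of `GL₈(F)`. -/
def orthogonalGroupOf (F : Type*) [Field F] (Q : (Fin 8 → F) → F) :
    Subgroup (GL (Fin 8) F) where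
  carrier := {g | ∀ v, Q ((g : Matrix (Fin 8) (Fin 8) F).mulVec v) = Q v}
  one_mem' := by
    intro v
    simp
  mul_mem' := by
    intro a b ha hb v
    have h : ((a * b : GL (Fin 8) F) : Matrix (Fin 8) (Fin 8) F).mulVec v
        = (a : Matrix (Fin 8) (Fin 8) F).mulVec
            ((b : Matrix (Fin 8) (Fin 8) F).mulVec v) := by
      simp [Matrix.mulVec_mulVec]
    rw [h, ha, hb]
  inv_mem' := by
    intro a ha v
    have h1 : (a : Matrix (Fin 8) (Fin 8) F).mulVec
        (((a⁻¹ : GL (Fin 8) F) : Matrix (Fin 8) (Fin 8) F).mulVec v) = v := by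
      rw [Matrix.mulVec_mulVec, ← Units.val_mul, mul_inv_cancel]
      simp
    calc Q (((a⁻¹ : GL (Fin 8) F) : Matrix (Fin 8) (Fin 8) F).mulVec v)
        = Q ((a : Matrix (Fin 8) (Fin 8) F).mulVec
            (((a⁻¹ : GL (Fin 8) F) : Matrix (Fin 8) (Fin 8) F).mulVec v)) := (ha _).symm
      _ = Q v := by rw [h1]

open QuadraticMap (polar)

section SiegelCalculus

variable {F V : Type*} [Field F] [AddCommGroup V] [Module F V]

/-- The isometry group of a quadratic form, as a subgroup of the general linear group. -/
def isometryGroup (Q : QuadraticForm F V) : Subgroup (V ≃ₗ[F] V) where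
  carrier := {g | ∀ v, Q (g v) = Q v}
  one_mem' := fun _ => rfl
  mul_mem' := fun {a b} ha hb v => by rw [LinearEquiv.mul_apply, ha, hb]
  inv_mem' := fun {a} ha v => by
    rw [← ha (a⁻¹ v), ← LinearEquiv.mul_apply, mul_inv_cancel, LinearEquiv.coe_one, id]

theorem mem_isometryGroup {Q : QuadraticForm F V} {g : V ≃ₗ[F] V} :
    g ∈ isometryGroup Q ↔ ∀ v, Q (g v) = Q v := Iff.rfl

theorem polar_isometry {Q : QuadraticForm F V} {g : V ≃ₗ[F] V} (hg : g ∈ isometryGroup Q)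
    (u v : V) : polar Q (g u) (g v) = polar Q u v := by
  simp only [polar, ← map_add, hg _]

/-- The Siegel transformation attached to a singular vector `e` and a vector `w` orthogonal
to `e`. -/
def siegelMap (Q : QuadraticForm F V) (e w : V) : V →ₗ[F] V :=
  LinearMap.id + (Q.polarBilin.flip e).smulRight w - (Q.polarBilin.flip w).smulRight e
    - Q w • (Q.polarBilin.flip e).smulRight e

variable {Q : QuadraticForm F V}

theorem siegelMap_apply (e w v : V) : siegelMap Q e w v =
    v + polar Q v e • w - polar Q v w • e - (Q w * polar Q v e) • e := by
  simp [siegelMap, mul_smul]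

theorem polar_self_of_singular {e : V} (he : Q e = 0) : polar Q e e = 0 := by
  rw [QuadraticMap.polar_self, he, smul_zero]

theorem map_add_polar (u v : V) : Q (u + v) = Q u + Q v + polar Q u v :=
  QuadraticMap.map_add Q u v

theorem siegelMap_add {e w w' : V} (he : Q e = 0) (hw : polar Q e w = 0)
    (hw' : polar Q e w' = 0) (v : V) :
    siegelMap Q e w (siegelMap Q e w' v) = siegelMap Q e (w + w') v := by
  have h1 : polar Q w' e = 0 := by rw [QuadraticMap.polar_comm, hw']
  have h2 : polar Q w' w = polar Q w w' := QuadraticMap.polar_comm _ _ _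
  simp only [siegelMap_apply, QuadraticMap.polar_add_left, QuadraticMap.polar_sub_left,
    QuadraticMap.polar_smul_left, QuadraticMap.polar_add_right, map_add_polar,
    polar_self_of_singular he, h1, hw, h2, smul_eq_mul]
  module

theorem siegelMap_zero (e v : V) : siegelMap Q e 0 v = v := by
  simp [siegelMap_apply]

theorem map_siegelMap {e w : V} (he : Q e = 0) (hw : polar Q e w = 0) (v : V) :
    Q (siegelMap Q e w v) = Q v := by
  have h1 : polar Q w e = 0 := by rw [QuadraticMap.polar_comm, hw]
  simp only [siegelMap_apply, sub_eq_add_neg, ← neg_smul, map_add_polar, QuadraticMap.map_smul,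
    QuadraticMap.polar_add_left, QuadraticMap.polar_smul_left, QuadraticMap.polar_smul_right,
    he, h1, polar_self_of_singular he, smul_eq_mul]
  ring

/-- The Siegel transformation as a linear automorphism. -/
def siegelEquiv {e w : V} (he : Q e = 0) (hw : polar Q e w = 0) : V ≃ₗ[F] V :=
  LinearEquiv.ofLinearMap (siegelMap Q e w) (siegelMap Q e (-w))
    (LinearMap.ext fun v => by
      have h : polar Q e (-w) = 0 := by rw [QuadraticMap.polar_neg_right, hw, neg_zero]
      simp [siegelMap_add he hw h, siegelMap_zero])
    (LinearMap.ext fun v => by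
      have h : polar Q e (-w) = 0 := by rw [QuadraticMap.polar_neg_right, hw, neg_zero]
      simp [siegelMap_add he h hw, siegelMap_zero])

@[simp]
theorem siegelEquiv_apply {e w : V} (he : Q e = 0) (hw : polar Q e w = 0) (v : V) :
    siegelEquiv he hw v = siegelMap Q e w v := rfl

theorem siegelEquiv_mem {e w : V} (he : Q e = 0) (hw : polar Q e w = 0) :
    siegelEquiv he hw ∈ isometryGroup Q := map_siegelMap he hw

theorem siegelMap_conj {g : V ≃ₗ[F] V} (hg : g ∈ isometryGroup Q) (e w v : V) :
    g (siegelMap Q e w v) = siegelMap Q (g e) (g w) (g v) := by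
  simp only [siegelMap_apply, polar_isometry hg, map_add, map_sub, map_smul, hg w]

/-- `SiegelMem Q H e w` says that `e` is singular, `w` is orthogonal to `e` and the Siegel
transformation attached to `e` and `w` lies in `H`. -/
def SiegelMem (Q : QuadraticForm F V) (H : Subgroup (V ≃ₗ[F] V)) (e w : V) : Prop :=
  Q e = 0 ∧ polar Q e w = 0 ∧ ∃ g ∈ H, ∀ v, g v = siegelMap Q e w v

namespace SiegelMem

variable {H : Subgroup (V ≃ₗ[F] V)} {e w w' e' : V}

theorem zero (he : Q e = 0) : SiegelMem Q H e 0 :=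
  ⟨he, by simp, 1, H.one_mem, fun v => by simp [siegelMap_zero]⟩

theorem add (h : SiegelMem Q H e w) (h' : SiegelMem Q H e w') : SiegelMem Q H e (w + w') := by
  obtain ⟨he, hw, g, hg, hgv⟩ := h
  obtain ⟨-, hw', g', hg', hgv'⟩ := h'
  refine ⟨he, by rw [QuadraticMap.polar_add_right, hw, hw', add_zero], g * g',
    H.mul_mem hg hg', fun v => ?_⟩
  rw [LinearEquiv.mul_apply, hgv', hgv, siegelMap_add he hw hw']

theorem neg (h : SiegelMem Q H e w) : SiegelMem Q H e (-w) := by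
  obtain ⟨he, hw, g, hg, hgv⟩ := h
  have h' : polar Q e (-w) = 0 := by rw [QuadraticMap.polar_neg_right, hw, neg_zero]
  refine ⟨he, h', g⁻¹, H.inv_mem hg, fun v => g.injective ?_⟩
  rw [← LinearEquiv.mul_apply, mul_inv_cancel, hgv, siegelMap_add he hw h']
  simp [siegelMap_zero]

theorem sub (h : SiegelMem Q H e w) (h' : SiegelMem Q H e w') : SiegelMem Q H e (w - w') := by
  rw [sub_eq_add_neg]
  exact h.add h'.neg

theorem congr (h : SiegelMem Q H e w) (he : e = e') (hw : w = w') : SiegelMem Q H e' w' := by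
  rwa [← he, ← hw]

theorem add_self (h : SiegelMem Q H e w) (c : F) : SiegelMem Q H e (w + c • e) := by
  obtain ⟨he, hw, g, hg, hgv⟩ := h
  have h1 : polar Q w e = 0 := by rw [QuadraticMap.polar_comm, hw]
  refine ⟨he, by simp [hw, polar_self_of_singular he], g, hg, fun v => ?_⟩
  rw [hgv]
  simp only [siegelMap_apply, map_add_polar, QuadraticMap.map_smul, he, h1, smul_eq_mul,
    QuadraticMap.polar_add_right, QuadraticMap.polar_smul_right]
  module

theorem swap (h : SiegelMem Q H e w) (hQ : Q w = 0) : SiegelMem Q H w (-e) := by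
  obtain ⟨he, hw, g, hg, hgv⟩ := h
  refine ⟨hQ, by rw [QuadraticMap.polar_neg_right, QuadraticMap.polar_comm, hw, neg_zero],
    g, hg, fun v => ?_⟩
  rw [hgv]
  simp only [siegelMap_apply, hQ, he, QuadraticMap.polar_neg_right, QuadraticMap.map_neg]
  module

theorem of_smul {c : F} (hc : c ≠ 0) (h : SiegelMem Q H (c • e) w) :
    SiegelMem Q H e (c • w) := by
  obtain ⟨he, hw, g, hg, hgv⟩ := h
  have h1 : Q e = 0 := by simpa [QuadraticMap.map_smul, hc] using he
  refine ⟨h1, by simpa using hw, g, hg, fun v => ?_⟩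
  rw [hgv]
  simp only [siegelMap_apply, QuadraticMap.map_smul, QuadraticMap.polar_smul_right, smul_eq_mul]
  module

theorem conj (hH : H ≤ isometryGroup Q) (h : SiegelMem Q H e w) {k : V ≃ₗ[F] V} (hk : k ∈ H) :
    SiegelMem Q H (k e) (k w) := by
  obtain ⟨he, hw, g, hg, hgv⟩ := h
  refine ⟨by rw [hH hk, he], by rw [polar_isometry (hH hk), hw], k * g * k⁻¹,
    H.mul_mem (H.mul_mem hk hg) (H.inv_mem hk), fun v => ?_⟩
  have h1 : k (k⁻¹ v) = v := by
    rw [← LinearEquiv.mul_apply, mul_inv_cancel, LinearEquiv.coe_one, id]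
  rw [LinearEquiv.mul_apply, LinearEquiv.mul_apply, hgv, siegelMap_conj (hH hk), h1]

theorem conj_siegel (hH : H ≤ isometryGroup Q) (h : SiegelMem Q H e w)
    (h' : SiegelMem Q H e' w') : SiegelMem Q H (siegelMap Q e' w' e) (siegelMap Q e' w' w) := by
  obtain ⟨-, -, k, hk, hkv⟩ := h'
  rw [← hkv, ← hkv]
  exact h.conj hH hk

end SiegelMem

/-- The subgroup generated by all Siegel transformations. -/
def siegelSubgroup (Q : QuadraticForm F V) : Subgroup (V ≃ₗ[F] V) :=
  Subgroup.closure {g | ∃ e w, Q e = 0 ∧ polar Q e w = 0 ∧ ∀ v, g v = siegelMap Q e w v}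

theorem siegelMem_siegelSubgroup {e w : V} (he : Q e = 0) (hw : polar Q e w = 0) :
    SiegelMem Q (siegelSubgroup Q) e w :=
  ⟨he, hw, siegelEquiv he hw, Subgroup.subset_closure ⟨e, w, he, hw, fun _ => rfl⟩,
    fun _ => rfl⟩

theorem siegelSubgroup_le_isometryGroup : siegelSubgroup Q ≤ isometryGroup Q := by
  refine (Subgroup.closure_le _).2 ?_
  rintro g ⟨e, w, he, hw, hg⟩ v
  rw [hg, map_siegelMap he hw]

theorem conj_mem_siegelSubgroup {g t : V ≃ₗ[F] V} (hg : g ∈ isometryGroup Q)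
    (ht : t ∈ siegelSubgroup Q) : g * t * g⁻¹ ∈ siegelSubgroup Q := by
  have key : siegelSubgroup Q ≤ (siegelSubgroup Q).comap (MulAut.conj g).toMonoidHom := by
    refine (Subgroup.closure_le _).2 ?_
    rintro t ⟨e, w, he, hw, ht⟩
    refine Subgroup.subset_closure ⟨g e, g w, by rw [hg, he],
      by rw [polar_isometry hg, hw], fun v => ?_⟩
    have h1 : g (g⁻¹ v) = v := by
      rw [← LinearEquiv.mul_apply, mul_inv_cancel, LinearEquiv.coe_one, id]
    change g (t (g⁻¹ v)) = _
    rw [ht, siegelMap_conj hg, h1]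
  exact key ht

end SiegelCalculus

section Transitivity

variable {F V : Type*} [Field F] [AddCommGroup V] [Module F V] {Q : QuadraticForm F V}

/-- All Siegel transformations attached to `z` lie in `H`. -/
def FullSiegel (Q : QuadraticForm F V) (H : Subgroup (V ≃ₗ[F] V)) (z : V) : Prop :=
  ∀ w, polar Q z w = 0 → SiegelMem Q H z w

/-- Two mutually orthogonal hyperbolic pairs. -/
structure TwoHyperbolicPairs (Q : QuadraticForm F V) (a a' b b' : V) : Prop where
  a_sing : Q a = 0
  a'_sing : Q a' = 0
  b_sing : Q b = 0
  b'_sing : Q b' = 0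
  aa' : polar Q a a' = 1
  bb' : polar Q b b' = 1
  ab : polar Q a b = 0
  ab' : polar Q a b' = 0
  dual_left : polar Q a' b = 0
  dual_dual : polar Q a' b' = 0

theorem fullSiegel_siegelSubgroup {z : V} (hz : Q z = 0) : FullSiegel Q (siegelSubgroup Q) z :=
  fun _ hw => siegelMem_siegelSubgroup hz hw

theorem exists_clear {H : Subgroup (V ≃ₗ[F] V)} {z z' : V} (hz : Q z = 0) (hz' : Q z' = 0)
    (hzz' : polar Q z z' = 1) (hS : FullSiegel Q H z) {v : V} (hv : polar Q v z ≠ 0) :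
    ∃ h ∈ H, h v = polar Q v z • z' + (Q v / polar Q v z) • z := by
  set l := polar Q v z with hl
  have hz'z : polar Q z' z = 1 := by rw [QuadraticMap.polar_comm, hzz']
  have hzv : polar Q z v = l := by rw [QuadraticMap.polar_comm]
  have hz'v : polar Q z' v = polar Q v z' := by rw [QuadraticMap.polar_comm]
  set m := polar Q v z' with hm
  obtain ⟨-, -, h, hh, hhv⟩ := hS (-l⁻¹ • (v - l • z' - m • z)) (by
    simp [hzv, hzz', polar_self_of_singular hz])
  refine ⟨h, hh, ?_⟩
  rw [hhv, siegelMap_apply, QuadraticMap.map_smul]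
  have hQ : Q (v - l • z' - m • z) = Q v - l * m := by
    simp only [sub_eq_add_neg, ← neg_smul, map_add_polar, QuadraticMap.map_smul, hz, hz',
      QuadraticMap.polar_add_left, QuadraticMap.polar_smul_left, QuadraticMap.polar_smul_right,
      smul_eq_mul, hz'z, ← hl, ← hm]
    ring
  have hP : polar Q v (v - l • z' - m • z) = 2 * (Q v - l * m) := by
    simp only [sub_eq_add_neg, ← neg_smul, QuadraticMap.polar_add_right,
      QuadraticMap.polar_smul_right, smul_eq_mul, ← hl, ← hm, QuadraticMap.polar_self,
      nsmul_eq_mul]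
    push_cast
    ring
  rw [hQ, QuadraticMap.polar_smul_right, hP, smul_eq_mul, smul_eq_mul, ← hl]
  match_scalars <;> field_simp <;> ring

namespace TwoHyperbolicPairs

variable {a a' b b' : V}

theorem symm (h : TwoHyperbolicPairs Q a a' b b') : TwoHyperbolicPairs Q b b' a a' where
  a_sing := h.b_sing
  a'_sing := h.b'_sing
  b_sing := h.a_sing
  b'_sing := h.a'_sing
  aa' := h.bb'
  bb' := h.aa'
  ab := by rw [QuadraticMap.polar_comm, h.ab]
  ab' := by rw [QuadraticMap.polar_comm, h.dual_left]
  dual_left := by rw [QuadraticMap.polar_comm, h.ab']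
  dual_dual := by rw [QuadraticMap.polar_comm, h.dual_dual]

theorem flip (h : TwoHyperbolicPairs Q a a' b b') : TwoHyperbolicPairs Q a' a b b' where
  a_sing := h.a'_sing
  a'_sing := h.a_sing
  b_sing := h.b_sing
  b'_sing := h.b'_sing
  aa' := by rw [QuadraticMap.polar_comm, h.aa']
  bb' := h.bb'
  ab := h.dual_left
  ab' := h.dual_dual
  dual_left := h.ab
  dual_dual := h.ab'

variable {H : Subgroup (V ≃ₗ[F] V)}

theorem exists_move (h : TwoHyperbolicPairs Q a a' b b') (hH : H ≤ isometryGroup Q)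
    (hSa : FullSiegel Q H a) (hSb : FullSiegel Q H b) {v : V} (hv : polar Q v a ≠ 0) :
    ∃ g ∈ H, g v = b' + Q v • b := by
  obtain ⟨g, hg, hgv⟩ := exists_clear h.a_sing h.a'_sing h.aa' hSa hv
  set l := polar Q v a with hl
  have h1 : polar Q a' a = 1 := by rw [QuadraticMap.polar_comm, h.aa']
  have h2 : polar Q b' b = 1 := by rw [QuadraticMap.polar_comm, h.bb']
  obtain ⟨-, -, k, hk, hkv⟩ := hSa (l⁻¹ • b') (by simp [h.ab'])
  have hkg : k (g v) = g v + b' := by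
    rw [hkv, hgv, siegelMap_apply]
    simp only [QuadraticMap.map_smul, QuadraticMap.polar_add_left, QuadraticMap.polar_smul_left,
      QuadraticMap.polar_smul_right, smul_eq_mul, h.dual_dual, h.ab', h.b'_sing, h1,
      polar_self_of_singular h.a_sing]
    match_scalars <;> field_simp <;> ring
  have hp : polar Q (k (g v)) b = 1 := by
    rw [hkg, hgv]
    simp [h.dual_left, h.ab, h2]
  obtain ⟨j, hj, hjv⟩ := exists_clear h.b_sing h.b'_sing h.bb' hSb
    (v := k (g v)) (by rw [hp]; exact one_ne_zero)
  refine ⟨j * k * g, H.mul_mem (H.mul_mem hj hk) hg, ?_⟩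
  rw [LinearEquiv.mul_apply, LinearEquiv.mul_apply, hjv, hp, hH hk, hH hg, div_one, one_smul]

theorem exists_move_of_ne_zero (h : TwoHyperbolicPairs Q a a' b b') (hH : H ≤ isometryGroup Q)
    (hSa : FullSiegel Q H a) (hSa' : FullSiegel Q H a') (hSb : FullSiegel Q H b)
    (hnd : ∀ u : V, (∀ v, polar Q u v = 0) → u = 0) {v : V} (hv : v ≠ 0) :
    ∃ g ∈ H, g v = b' + Q v • b := by
  by_cases h1 : polar Q v a = 0
  · by_cases h2 : polar Q v a' = 0
    · obtain ⟨u, hu⟩ : ∃ u, polar Q v u ≠ 0 := by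
        by_contra! hcon
        exact hv (hnd v hcon)
      have h3 : polar Q a' a = 1 := by rw [QuadraticMap.polar_comm, h.aa']
      have h4 : polar Q a' u = polar Q u a' := by rw [QuadraticMap.polar_comm]
      obtain ⟨-, -, k, hk, hkv⟩ := hSa' (u - polar Q u a • a' - polar Q u a' • a) (by
        simp [QuadraticMap.polar_sub_right, polar_self_of_singular h.a'_sing, h3, h4])
      have h5 : polar Q (k v) a ≠ 0 := by
        rw [hkv, siegelMap_apply]
        simp [QuadraticMap.polar_sub_left, QuadraticMap.polar_sub_right, h1, h2, h3, hu]
      obtain ⟨g, hg, hgv⟩ := h.exists_move hH hSa hSb h5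
      exact ⟨g * k, H.mul_mem hg hk, by rw [LinearEquiv.mul_apply, hgv, hH hk]⟩
    · exact h.flip.exists_move hH hSa' hSb h2
  · exact h.exists_move hH hSa hSb h1

/-- Enough Siegel transformations on two hyperbolic pairs generate all of them. -/
theorem siegelSubgroup_le (h : TwoHyperbolicPairs Q a a' b b') (hH : H ≤ isometryGroup Q)
    (hSa : FullSiegel Q H a) (hSa' : FullSiegel Q H a') (hSb : FullSiegel Q H b)
    (hSb' : FullSiegel Q H b') (hnd : ∀ u : V, (∀ v, polar Q u v = 0) → u = 0) :
    siegelSubgroup Q ≤ H := by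
  refine (Subgroup.closure_le _).2 ?_
  rintro t ⟨e, w, he, hw, ht⟩
  by_cases h0 : e = 0
  · have : t = 1 := by
      ext v
      rw [ht, h0, siegelMap_apply]
      simp
    rw [this]
    exact H.one_mem
  · obtain ⟨g, hg, hge⟩ := h.exists_move_of_ne_zero hH hSa hSa' hSb hnd h0
    rw [he, zero_smul, add_zero] at hge
    have h1 := (hSb' (g w) (by rw [← hge, polar_isometry (hH hg), hw])).conj hH (H.inv_mem hg)
    have h2 (u : V) : g⁻¹ (g u) = u := by
      rw [← LinearEquiv.mul_apply, inv_mul_cancel, LinearEquiv.coe_one, id]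
    rw [← hge, h2, h2] at h1
    obtain ⟨-, -, k, hk, hkv⟩ := h1
    have : t = k := by
      ext v
      rw [ht, hkv]
    rw [this]
    exact hk

end TwoHyperbolicPairs

end Transitivity

section Reflections

variable {F V : Type*} [Field F] [AddCommGroup V] [Module F V] {Q : QuadraticForm F V}

/-- The reflection in a vector `v` which is not singular. -/
def reflEquiv {v : V} (hv : Q v ≠ 0) : V ≃ₗ[F] V :=
  LinearEquiv.ofInvolutive (LinearMap.id - (Q v)⁻¹ • (Q.polarBilin.flip v).smulRight v) (by
    intro u
    have h : polar Q v v = 2 * Q v := by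
      rw [QuadraticMap.polar_self, nsmul_eq_mul, Nat.cast_ofNat]
    simp only [LinearMap.sub_apply, LinearMap.id_apply, LinearMap.smul_apply,
      LinearMap.smulRight_apply, LinearMap.flip_apply, QuadraticMap.polarBilin_apply_apply,
      QuadraticMap.polar_sub_left, QuadraticMap.polar_smul_left, h, smul_eq_mul]
    match_scalars <;> field_simp; ring)

theorem reflEquiv_apply {v : V} (hv : Q v ≠ 0) (u : V) :
    reflEquiv hv u = u - (polar Q u v / Q v) • v := by
  change u - (Q v)⁻¹ • (polar Q u v • v) = _
  rw [smul_smul, div_eq_inv_mul]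

theorem reflEquiv_mem {v : V} (hv : Q v ≠ 0) : reflEquiv hv ∈ isometryGroup Q := by
  intro u
  rw [reflEquiv_apply, sub_eq_add_neg, ← neg_smul, map_add_polar, QuadraticMap.map_smul,
    QuadraticMap.polar_smul_right, smul_eq_mul, smul_eq_mul]
  field_simp
  ring

theorem reflEquiv_of_orthogonal {v u : V} (hv : Q v ≠ 0) (h : polar Q u v = 0) :
    reflEquiv hv u = u := by
  simp [reflEquiv_apply, h]

theorem isometry_reflEquiv {v : V} (hv : Q v ≠ 0) {g : V ≃ₗ[F] V} (hg : g ∈ isometryGroup Q)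
    (hgv : Q (g v) ≠ 0) (u : V) : g (reflEquiv hv u) = reflEquiv hgv (g u) := by
  simp only [reflEquiv_apply, map_sub, map_smul, polar_isometry hg, hg v]

theorem conj_reflEquiv {v : V} (hv : Q v ≠ 0) {g : V ≃ₗ[F] V} (hg : g ∈ isometryGroup Q)
    (hgv : Q (g v) ≠ 0) : g * reflEquiv hv * g⁻¹ = reflEquiv hgv := by
  rw [mul_inv_eq_iff_eq_mul]
  ext u
  exact isometry_reflEquiv hv hg hgv u

theorem commute_reflEquiv {v w : V} (hv : Q v ≠ 0) (hw : Q w ≠ 0) (h : polar Q v w = 0) :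
    Commute (reflEquiv hv) (reflEquiv hw) := by
  have h' : polar Q w v = 0 := by rw [QuadraticMap.polar_comm, h]
  ext u
  simp only [LinearEquiv.mul_apply, reflEquiv_apply, QuadraticMap.polar_sub_left,
    QuadraticMap.polar_smul_left, h, h', smul_zero, sub_zero]
  abel

/-- The subgroup generated by Siegel transformations and reflections. -/
def siegelReflSubgroup (Q : QuadraticForm F V) : Subgroup (V ≃ₗ[F] V) :=
  Subgroup.closure ({g | ∃ e w, Q e = 0 ∧ polar Q e w = 0 ∧ ∀ v, g v = siegelMap Q e w v} ∪
    {g | ∃ (v : V) (hv : Q v ≠ 0), g = reflEquiv hv})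

theorem siegelReflSubgroup_le : siegelReflSubgroup Q ≤ isometryGroup Q := by
  refine (Subgroup.closure_le _).2 ?_
  rintro g (⟨e, w, he, hw, hg⟩ | ⟨v, hv, rfl⟩)
  · intro v
    rw [hg, map_siegelMap he hw]
  · exact reflEquiv_mem hv

theorem reflEquiv_mem_siegelReflSubgroup {v : V} (hv : Q v ≠ 0) :
    reflEquiv hv ∈ siegelReflSubgroup Q :=
  Subgroup.subset_closure (Or.inr ⟨v, hv, rfl⟩)

theorem siegelEquiv_mem_siegelReflSubgroup {e w : V} (he : Q e = 0) (hw : polar Q e w = 0) :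
    siegelEquiv he hw ∈ siegelReflSubgroup Q :=
  Subgroup.subset_closure (Or.inl ⟨e, w, he, hw, fun _ => rfl⟩)

/-- `g` can be multiplied by a product of Siegel transformations and reflections to give an
isometry which fixes every vector of `P`. -/
def CanFix (Q : QuadraticForm F V) (P : Set V) (g : V ≃ₗ[F] V) : Prop :=
  ∃ h ∈ siegelReflSubgroup Q, ∀ p ∈ P, h (g p) = p

/-- Multiplication by a reflection moves `g u` to `u` and fixes what `g` fixes. -/
theorem reflEquiv_sub {g : V ≃ₗ[F] V} (hg : g ∈ isometryGroup Q) {u : V}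
    (hu : Q (g u - u) ≠ 0) : reflEquiv hu (g u) = u := by
  have h : polar Q (g u) (g u - u) = Q (g u - u) := by
    have h1 := hg u
    simp only [sub_eq_add_neg, map_add_polar, QuadraticMap.polar_add_right,
      QuadraticMap.polar_neg_right, QuadraticMap.polar_self, QuadraticMap.map_neg, h1,
      nsmul_eq_mul]
    push_cast
    ring
  rw [reflEquiv_apply, h, div_self hu, one_smul, sub_sub_cancel]

theorem reflEquiv_sub_fixed {g : V ≃ₗ[F] V} (hg : g ∈ isometryGroup Q) {u p : V}
    (hu : Q (g u - u) ≠ 0) (hp : g p = p) : reflEquiv hu p = p := by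
  refine reflEquiv_of_orthogonal hu ?_
  have h := polar_isometry hg p u
  rw [hp] at h
  rw [QuadraticMap.polar_sub_right, h, sub_self]

theorem CanFix.insert_of_anisotropic {P : Set V} {u : V}
    (hu : ∀ g ∈ isometryGroup Q, (∀ p ∈ P, g p = p) → g u = u ∨ Q (g u - u) ≠ 0)
    {g : V ≃ₗ[F] V} (hg : g ∈ isometryGroup Q) (h : CanFix Q P g) :
    CanFix Q (insert u P) g := by
  obtain ⟨k, hk, hkP⟩ := h
  have hkg : k * g ∈ isometryGroup Q := mul_mem (siegelReflSubgroup_le hk) hg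
  rcases hu (k * g) hkg hkP with h1 | h1
  · refine ⟨k, hk, ?_⟩
    rintro p (rfl | hp)
    · exact h1
    · exact hkP p hp
  · refine ⟨reflEquiv h1 * k, mul_mem (reflEquiv_mem_siegelReflSubgroup h1) hk, ?_⟩
    rintro p (rfl | hp)
    · exact reflEquiv_sub hkg h1
    · rw [LinearEquiv.mul_apply, hkP p hp]
      exact reflEquiv_sub_fixed hkg h1 (hkP p hp)

theorem map_sub_of_singular {u v : V} (hu : Q u = 0) (hv : Q v = 0) :
    Q (u - v) = - polar Q u v := by
  rw [sub_eq_add_neg, map_add_polar, QuadraticMap.map_neg, hu, hv,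
    QuadraticMap.polar_neg_right]
  ring

theorem exists_refl_of_singular {P : Set V} {u v : V} (hu : Q u = 0) (hv : Q v = 0)
    (huv : polar Q u v ≠ 0) (huP : ∀ p ∈ P, polar Q p u = 0) (hvP : ∀ p ∈ P, polar Q p v = 0) :
    ∃ h ∈ siegelReflSubgroup Q, h u = v ∧ ∀ p ∈ P, h p = p := by
  have h1 : Q (u - v) ≠ 0 := by rw [map_sub_of_singular hu hv]; exact neg_ne_zero.2 huv
  refine ⟨reflEquiv h1, reflEquiv_mem_siegelReflSubgroup h1, ?_, fun p hp => ?_⟩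
  · rw [reflEquiv_apply, QuadraticMap.polar_sub_right, polar_self_of_singular hu, zero_sub,
      map_sub_of_singular hu hv, div_self (neg_ne_zero.2 huv), one_smul, sub_sub_cancel]
  · refine reflEquiv_of_orthogonal h1 ?_
    rw [QuadraticMap.polar_sub_right, huP p hp, hvP p hp, sub_zero]

theorem exists_move_singular {P : Set V} {z z' : V} (hz : Q z = 0) (hz' : Q z' = 0)
    (hzz' : polar Q z z' = 1) (hPz : ∀ p ∈ P, polar Q p z = 0)
    (hPz' : ∀ p ∈ P, polar Q p z' = 0) {g : V ≃ₗ[F] V} (hg : g ∈ isometryGroup Q)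
    (hgP : ∀ p ∈ P, g p = p) :
    ∃ h ∈ siegelReflSubgroup Q, h (g z) = z ∧ ∀ p ∈ P, h p = p := by
  have hgz : Q (g z) = 0 := by rw [hg, hz]
  have hgzP : ∀ p ∈ P, polar Q p (g z) = 0 := fun p hp => by
    rw [← hPz p hp, ← polar_isometry hg p z, hgP p hp]
  have hgz'P : ∀ p ∈ P, polar Q p (g z') = 0 := fun p hp => by
    rw [← hPz' p hp, ← polar_isometry hg p z', hgP p hp]
  have hz'z : polar Q z' z = 1 := by rw [QuadraticMap.polar_comm, hzz']
  by_cases h1 : polar Q (g z) z = 0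
  · by_cases h2 : polar Q (g z) z' = 0
    · set w := g z' - polar Q (g z') z • z' - polar Q (g z') z' • z with hw
      have hwz' : polar Q z' w = 0 := by
        rw [hw]
        simp [QuadraticMap.polar_sub_right, polar_self_of_singular hz', hz'z,
          QuadraticMap.polar_comm _ z' (g z')]
      have hwP : ∀ p ∈ P, polar Q p w = 0 := fun p hp => by
        rw [hw]
        simp [QuadraticMap.polar_sub_right, hgz'P p hp, hPz p hp, hPz' p hp]
      have hzw : polar Q (g z) w = 1 := by
        rw [hw]
        simp [QuadraticMap.polar_sub_right, polar_isometry hg, hzz', h1, h2]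
      have hk : siegelEquiv hz' hwz' (g z) = g z - z' := by
        rw [siegelEquiv_apply, siegelMap_apply, hzw, h2]
        simp
      obtain ⟨k, hkm, hkz, hkP⟩ := exists_refl_of_singular (P := P) (u := g z - z') (v := z)
        (by rw [map_sub_of_singular hgz hz', h2, neg_zero]) hz
        (by rw [QuadraticMap.polar_sub_left, h1, hz'z]; simp)
        (fun p hp => by rw [QuadraticMap.polar_sub_right, hgzP p hp, hPz' p hp, sub_zero]) hPz
      refine ⟨k * siegelEquiv hz' hwz',
        mul_mem hkm (siegelEquiv_mem_siegelReflSubgroup hz' hwz'), ?_, fun p hp => ?_⟩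
      · rw [LinearEquiv.mul_apply, hk, hkz]
      · rw [LinearEquiv.mul_apply, siegelEquiv_apply, siegelMap_apply, hwP p hp, hPz' p hp]
        simpa using hkP p hp
    · obtain ⟨k, hk, hkz, hkP⟩ := exists_refl_of_singular hgz hz' h2 hgzP hPz'
      obtain ⟨j, hj, hjz, hjP⟩ := exists_refl_of_singular hz' hz
        (by rw [hz'z]; exact one_ne_zero) hPz' hPz
      refine ⟨j * k, mul_mem hj hk, by rw [LinearEquiv.mul_apply, hkz, hjz], fun p hp => ?_⟩
      rw [LinearEquiv.mul_apply, hkP p hp, hjP p hp]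
  · exact exists_refl_of_singular hgz hz h1 hgzP hPz

theorem exists_fix_partner {P : Set V} {z z' : V} (hz : Q z = 0) (hz' : Q z' = 0)
    (hzz' : polar Q z z' = 1) (hPz : ∀ p ∈ P, polar Q p z = 0)
    (hPz' : ∀ p ∈ P, polar Q p z' = 0) {g : V ≃ₗ[F] V} (hg : g ∈ isometryGroup Q)
    (hgP : ∀ p ∈ P, g p = p) (hgz : g z = z) :
    ∃ h ∈ siegelReflSubgroup Q, h z = z ∧ h z' = g z' ∧ ∀ p ∈ P, h p = p := by
  have hgz' : Q (g z') = 0 := by rw [hg, hz']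
  have hgz'P : ∀ p ∈ P, polar Q p (g z') = 0 := fun p hp => by
    rw [← hPz' p hp, ← polar_isometry hg p z', hgP p hp]
  have hz'z : polar Q z' z = 1 := by rw [QuadraticMap.polar_comm, hzz']
  have h1 : polar Q z (g z') = 1 := by
    rw [← hzz', ← polar_isometry hg z z', hgz]
  have h2 : polar Q (g z') z = 1 := by rw [QuadraticMap.polar_comm, h1]
  set w := g z' - z' - polar Q (g z') z' • z with hw
  have hzw : polar Q z w = 0 := by
    rw [hw]
    simp [QuadraticMap.polar_sub_right, polar_self_of_singular hz, hzz', h1]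
  have hwP : ∀ p ∈ P, polar Q p w = 0 := fun p hp => by
    rw [hw]
    simp [QuadraticMap.polar_sub_right, hgz'P p hp, hPz p hp, hPz' p hp]
  have hz'w : polar Q z' w = 0 := by
    rw [hw]
    simp [QuadraticMap.polar_sub_right, polar_self_of_singular hz', hz'z,
      QuadraticMap.polar_comm _ z' (g z')]
  have hQw : Q w = - polar Q (g z') z' := by
    rw [hw, sub_eq_add_neg, map_add_polar, QuadraticMap.map_neg, QuadraticMap.map_smul, hz,
      map_sub_of_singular hgz' hz', QuadraticMap.polar_neg_right, QuadraticMap.polar_smul_right,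
      QuadraticMap.polar_sub_left, h2, hz'z]
    simp
  refine ⟨siegelEquiv hz hzw, siegelEquiv_mem_siegelReflSubgroup hz hzw, ?_, ?_,
    fun p hp => ?_⟩
  · rw [siegelEquiv_apply, siegelMap_apply, hzw, polar_self_of_singular hz]
    simp
  · rw [siegelEquiv_apply, siegelMap_apply, hz'w, hz'z, hQw, hw]
    module
  · rw [siegelEquiv_apply, siegelMap_apply, hwP p hp, hPz p hp]
    simp

theorem CanFix.insert_pair {P : Set V} {z z' : V} (hz : Q z = 0) (hz' : Q z' = 0)
    (hzz' : polar Q z z' = 1) (hPz : ∀ p ∈ P, polar Q p z = 0)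
    (hPz' : ∀ p ∈ P, polar Q p z' = 0) {g : V ≃ₗ[F] V} (hg : g ∈ isometryGroup Q)
    (h : CanFix Q P g) : CanFix Q (insert z (insert z' P)) g := by
  obtain ⟨k, hk, hkP⟩ := h
  have hkg : k * g ∈ isometryGroup Q := mul_mem (siegelReflSubgroup_le hk) hg
  obtain ⟨j, hj, hjz, hjP⟩ := exists_move_singular hz hz' hzz' hPz hPz' hkg hkP
  have hjkg : j * (k * g) ∈ isometryGroup Q := mul_mem (siegelReflSubgroup_le hj) hkg
  obtain ⟨i, hi, hiz, hiz', hiP⟩ := exists_fix_partner hz hz' hzz' hPz hPz' hjkg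
    (fun p hp => by rw [LinearEquiv.mul_apply, LinearEquiv.mul_apply, hkP p hp, hjP p hp]) hjz
  refine ⟨i⁻¹ * (j * k), mul_mem (inv_mem hi) (mul_mem hj hk), ?_⟩
  have hinv (u v : V) (huv : i u = v) : i⁻¹ v = u := by
    rw [← huv, ← LinearEquiv.mul_apply, inv_mul_cancel, LinearEquiv.coe_one, id]
  rintro p (rfl | rfl | hp)
  · exact hinv _ _ (hiz.trans hjz.symm)
  · exact hinv _ _ hiz'
  · refine hinv _ _ ?_
    rw [hiP p hp]
    change p = j (k (g p))
    rw [hkP p hp, hjP p hp]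

end Reflections

section Commutators

open scoped commutatorElement

variable {G : Type*} [Group G] {O T : Subgroup G}

/-- The elements of `O` commuting with `b` modulo a subgroup `T` normalised by `O`. -/
def commuteModulo (hn : ∀ g ∈ O, ∀ t ∈ T, g * t * g⁻¹ ∈ T) (b : G) :
    Subgroup G where
  carrier := {a | a ∈ O ∧ ⁅a, b⁆ ∈ T}
  one_mem' := ⟨O.one_mem, by rw [commutatorElement_one_left]; exact T.one_mem⟩
  mul_mem' := by
    rintro a a' ⟨ha, hab⟩ ⟨ha', ha'b⟩
    refine ⟨O.mul_mem ha ha', ?_⟩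
    have h : ⁅a * a', b⁆ = a * ⁅a', b⁆ * a⁻¹ * ⁅a, b⁆ := by
      simp only [commutatorElement_def]
      group
    rw [h]
    exact T.mul_mem (hn a ha _ ha'b) hab
  inv_mem' := by
    rintro a ⟨ha, hab⟩
    refine ⟨O.inv_mem ha, ?_⟩
    have h : ⁅a⁻¹, b⁆ = a⁻¹ * ⁅a, b⁆⁻¹ * a⁻¹⁻¹ := by
      simp only [commutatorElement_def]
      group
    rw [h]
    exact hn _ (O.inv_mem ha) _ (T.inv_mem hab)

variable {hn : ∀ g ∈ O, ∀ t ∈ T, g * t * g⁻¹ ∈ T} {a b : G}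

theorem commuteModulo_symm (hb : b ∈ O) (h : a ∈ commuteModulo hn b) :
    b ∈ commuteModulo hn a :=
  ⟨hb, by rw [← commutatorElement_inv]; exact T.inv_mem h.2⟩

theorem le_commuteModulo (hT : T ≤ O) (hb : b ∈ O) : T ≤ commuteModulo hn b := fun t ht =>
  ⟨hT ht, by
    have h : ⁅t, b⁆ = t * (b * t⁻¹ * b⁻¹) := by
      simp only [commutatorElement_def, mul_assoc]
    rw [h]
    exact T.mul_mem ht (hn b hb _ (T.inv_mem ht))⟩

theorem mem_commuteModulo_of_conj (hT : T ≤ O) {t : G} (ht : t ∈ T) (hb : b ∈ O)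
    (h : t * a * t⁻¹ ∈ commuteModulo hn b) : a ∈ commuteModulo hn b := by
  have h1 := le_commuteModulo (hn := hn) hT hb ht
  have h2 : a = t⁻¹ * (t * a * t⁻¹) * t := by group
  rw [h2]
  exact mul_mem (mul_mem (inv_mem h1) h) h1

end Commutators

section CommutatorBound

open scoped commutatorElement

variable {F V : Type*} [Field F] [AddCommGroup V] [Module F V] {Q : QuadraticForm F V}

theorem TwoHyperbolicPairs.commutator_le {a a' b b' : V} (h : TwoHyperbolicPairs Q a a' b b')
    (hnd : ∀ u : V, (∀ v, polar Q u v = 0) → u = 0)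
    (hgen : isometryGroup Q ≤ siegelReflSubgroup Q) :
    ⁅isometryGroup Q, isometryGroup Q⁆ ≤ siegelSubgroup Q := by
  have hT : siegelSubgroup Q ≤ isometryGroup Q := siegelSubgroup_le_isometryGroup
  have hn : ∀ g ∈ isometryGroup Q, ∀ t ∈ siegelSubgroup Q, g * t * g⁻¹ ∈ siegelSubgroup Q :=
    fun g hg t ht => conj_mem_siegelSubgroup hg ht
  have hmove : ∀ v : V, Q v ≠ 0 →
      (∃ g ∈ siegelSubgroup Q, g v = b' + Q v • b) ∧
      ∃ g ∈ siegelSubgroup Q, g v = a' + Q v • a := by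
    intro v hv
    have hv0 : v ≠ 0 := by
      rintro rfl
      exact hv (QuadraticMap.map_zero Q)
    exact ⟨h.exists_move_of_ne_zero hT (fullSiegel_siegelSubgroup h.a_sing)
        (fullSiegel_siegelSubgroup h.a'_sing) (fullSiegel_siegelSubgroup h.b_sing) hnd hv0,
      h.symm.exists_move_of_ne_zero hT (fullSiegel_siegelSubgroup h.b_sing)
        (fullSiegel_siegelSubgroup h.b'_sing) (fullSiegel_siegelSubgroup h.a_sing) hnd hv0⟩
  have hrefl : ∀ v (hv : Q v ≠ 0) w (hw : Q w ≠ 0),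
      reflEquiv hv ∈ commuteModulo hn (reflEquiv hw) := by
    intro v hv w hw
    obtain ⟨⟨s, hs, hsv⟩, -⟩ := hmove v hv
    obtain ⟨-, ⟨t, ht, htw⟩⟩ := hmove w hw
    have hsv0 : Q (s v) ≠ 0 := by rwa [hT hs v]
    have htw0 : Q (t w) ≠ 0 := by rwa [hT ht w]
    refine mem_commuteModulo_of_conj hT hs (reflEquiv_mem hw) ?_
    rw [conj_reflEquiv hv (hT hs) hsv0]
    refine commuteModulo_symm (reflEquiv_mem hsv0) ?_
    refine mem_commuteModulo_of_conj hT ht (reflEquiv_mem hsv0) ?_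
    rw [conj_reflEquiv hw (hT ht) htw0]
    refine ⟨reflEquiv_mem htw0, ?_⟩
    rw [commutatorElement_eq_one_iff_commute.2]
    · exact one_mem _
    · refine commute_reflEquiv _ _ ?_
      rw [hsv, htw]
      simp [h.ab, h.ab', h.dual_left, h.dual_dual]
  have hgens : ∀ b ∈ isometryGroup Q, (∀ v (hv : Q v ≠ 0),
      reflEquiv hv ∈ commuteModulo hn b) → isometryGroup Q ≤ commuteModulo hn b := by
    intro b hb hbv
    refine hgen.trans ((Subgroup.closure_le _).2 ?_)
    rintro g (hg | ⟨v, hv, rfl⟩)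
    · exact le_commuteModulo hT hb (Subgroup.subset_closure hg)
    · exact hbv v hv
  refine Subgroup.commutator_le.2 fun g₁ hg₁ g₂ hg₂ => ?_
  refine (hgens g₂ hg₂ (fun v hv => ?_) hg₁).2
  exact commuteModulo_symm (reflEquiv_mem hv)
    (hgens _ (reflEquiv_mem hv) (fun w hw => hrefl w hw v hv) hg₂)

end CommutatorBound

section MinusForm

variable {F : Type*} [Field F]

/-- The quadratic form `v₀v₃ + v₁v₄ + v₂v₅ + a v₆² + m v₆v₇ + a v₇²` on `F⁸`. -/
def minusForm (a m : F) : QuadraticForm F (Fin 8 → F) :=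
  QuadraticMap.linMulLin (LinearMap.proj 0) (LinearMap.proj 3) +
  QuadraticMap.linMulLin (LinearMap.proj 1) (LinearMap.proj 4) +
  QuadraticMap.linMulLin (LinearMap.proj 2) (LinearMap.proj 5) +
  a • QuadraticMap.linMulLin (LinearMap.proj 6) (LinearMap.proj 6) +
  m • QuadraticMap.linMulLin (LinearMap.proj 6) (LinearMap.proj 7) +
  a • QuadraticMap.linMulLin (LinearMap.proj 7) (LinearMap.proj 7)

theorem minusForm_apply (a m : F) (v : Fin 8 → F) : minusForm a m v =
    v 0 * v 3 + v 1 * v 4 + v 2 * v 5 + a * (v 6 * v 6) + m * (v 6 * v 7) + a * (v 7 * v 7) := by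
  simp [minusForm]

theorem polar_minusForm (a m : F) (u v : Fin 8 → F) : polar (minusForm a m) u v =
    u 0 * v 3 + u 3 * v 0 + u 1 * v 4 + u 4 * v 1 + u 2 * v 5 + u 5 * v 2 +
      2 * a * (u 6 * v 6) + m * (u 6 * v 7 + u 7 * v 6) + 2 * a * (u 7 * v 7) := by
  simp only [polar, minusForm_apply, Pi.add_apply]
  ring

theorem siegelMap_minusForm (a m : F) (e w v : Fin 8 → F) (i : Fin 8) :
    siegelMap (minusForm a m) e w v i = v i + polar (minusForm a m) v e * w i
      - polar (minusForm a m) v w * e i - minusForm a m w * polar (minusForm a m) v e * e i := by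
  simp [siegelMap_apply]

/-- The permutation of order three of the three hyperbolic pairs. -/
def cycleEquiv (F : Type*) [Field F] : (Fin 8 → F) ≃ₗ[F] (Fin 8 → F) where
  toFun v := ![v 2, v 0, v 1, v 5, v 3, v 4, v 6, v 7]
  invFun v := ![v 1, v 2, v 0, v 4, v 5, v 3, v 6, v 7]
  map_add' u v := by ext i; fin_cases i <;> simp
  map_smul' c v := by ext i; fin_cases i <;> simp
  left_inv v := by ext i; fin_cases i <;> simp
  right_inv v := by ext i; fin_cases i <;> simp

theorem cycleEquiv_apply (v : Fin 8 → F) :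
    cycleEquiv F v = ![v 2, v 0, v 1, v 5, v 3, v 4, v 6, v 7] := rfl

theorem cycleEquiv_mem (a m : F) : cycleEquiv F ∈ isometryGroup (minusForm a m) := by
  intro v
  simp [minusForm_apply, cycleEquiv_apply]
  ring

theorem cycleEquiv_pow_three : cycleEquiv F ^ 3 = 1 := by
  ext v i
  change cycleEquiv F (cycleEquiv F (cycleEquiv F v)) i = v i
  fin_cases i <;> simp [cycleEquiv_apply]

/-- The involution in the generating pair. -/
def involEquiv (a m c t : F) : (Fin 8 → F) ≃ₗ[F] (Fin 8 → F) :=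
  LinearEquiv.ofInvolutive
    { toFun := fun v => ![c * v 1 - a * v 2 + (t - c ^ 2) * v 3 + v 5 + 2 * a * v 6 + m * v 7,
        c * v 2 - v 4, v 3, v 2, c * v 3 - v 1,
        v 0 + (m - t) * v 2 - a * v 3 + c * v 4 - m * v 6 - 2 * a * v 7, v 3 + v 7, v 6 - v 2]
      map_add' := fun u v => by ext i; fin_cases i <;> simp <;> ring
      map_smul' := fun c v => by ext i; fin_cases i <;> simp <;> ring }
    (fun v => by ext i; fin_cases i <;> simp <;> ring)

theorem involEquiv_apply (a m c t : F) (v : Fin 8 → F) : involEquiv a m c t v =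
    ![c * v 1 - a * v 2 + (t - c ^ 2) * v 3 + v 5 + 2 * a * v 6 + m * v 7,
      c * v 2 - v 4, v 3, v 2, c * v 3 - v 1,
      v 0 + (m - t) * v 2 - a * v 3 + c * v 4 - m * v 6 - 2 * a * v 7, v 3 + v 7, v 6 - v 2] :=
  rfl

theorem involEquiv_mem (a m c t : F) : involEquiv a m c t ∈ isometryGroup (minusForm a m) := by
  intro v
  simp [minusForm_apply, involEquiv_apply]
  ring

theorem involEquiv_involutive (a m c t : F) (v : Fin 8 → F) :
    involEquiv a m c t (involEquiv a m c t v) = v :=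
  (involEquiv a m c t).symm_apply_apply v

theorem involEquiv_pow_two (a m c t : F) : involEquiv a m c t ^ 2 = 1 := by
  rw [pow_two]
  ext1 v
  exact involEquiv_involutive a m c t v

theorem orderOf_cycleEquiv : orderOf (cycleEquiv F) = 3 := by
  refine orderOf_eq_prime cycleEquiv_pow_three fun h => ?_
  have h1 := congrFun (LinearEquiv.congr_fun h ![1, 0, 0, 0, 0, 0, 0, 0]) 0
  simp [cycleEquiv_apply] at h1

theorem orderOf_involEquiv (a m c t : F) : orderOf (involEquiv a m c t) = 2 := by
  refine orderOf_eq_prime (involEquiv_pow_two a m c t) fun h => ?_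
  have h1 := congrFun (LinearEquiv.congr_fun h ![1, 0, 0, 0, 0, 0, 0, 0]) 0
  simp [involEquiv_apply] at h1

theorem minusForm_nondegenerate {a m : F} (ham : (2 * a) * (2 * a) - m * m ≠ 0)
    (u : Fin 8 → F) (hu : ∀ v, polar (minusForm a m) u v = 0) : u = 0 := by
  have h0 := hu ![1, 0, 0, 0, 0, 0, 0, 0]
  have h1 := hu ![0, 1, 0, 0, 0, 0, 0, 0]
  have h2 := hu ![0, 0, 1, 0, 0, 0, 0, 0]
  have h3 := hu ![0, 0, 0, 1, 0, 0, 0, 0]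
  have h4 := hu ![0, 0, 0, 0, 1, 0, 0, 0]
  have h5 := hu ![0, 0, 0, 0, 0, 1, 0, 0]
  have h6 := hu ![0, 0, 0, 0, 0, 0, 1, 0]
  have h7 := hu ![0, 0, 0, 0, 0, 0, 0, 1]
  simp [polar_minusForm] at h0 h1 h2 h3 h4 h5 h6 h7
  have h6' : (2 * a * (2 * a) - m * m) * u 6 = 0 := by linear_combination 2 * a * h6 - m * h7
  have h7' : (2 * a * (2 * a) - m * m) * u 7 = 0 := by linear_combination 2 * a * h7 - m * h6
  have h6'' := (mul_eq_zero.1 h6').resolve_left ham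
  have h7'' := (mul_eq_zero.1 h7').resolve_left ham
  ext i
  fin_cases i <;> simp [*]

theorem twoHyperbolicPairs_minusForm (a m : F) : TwoHyperbolicPairs (minusForm a m)
    ![1, 0, 0, 0, 0, 0, 0, 0] ![0, 0, 0, 1, 0, 0, 0, 0]
    ![0, 1, 0, 0, 0, 0, 0, 0] ![0, 0, 0, 0, 1, 0, 0, 0] := by
  constructor <;> simp [minusForm_apply, polar_minusForm]

theorem eq_zero_of_orthogonal_pairs {a m : F}
    (hE : ∀ s t : F, a * (s * s) + m * (s * t) + a * (t * t) = 0 → s = 0 ∧ t = 0)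
    {d : Fin 8 → F} (h0 : minusForm a m d = 0)
    (h1 : polar (minusForm a m) ![1, 0, 0, 0, 0, 0, 0, 0] d = 0)
    (h2 : polar (minusForm a m) ![0, 1, 0, 0, 0, 0, 0, 0] d = 0)
    (h3 : polar (minusForm a m) ![0, 0, 1, 0, 0, 0, 0, 0] d = 0)
    (h4 : polar (minusForm a m) ![0, 0, 0, 1, 0, 0, 0, 0] d = 0)
    (h5 : polar (minusForm a m) ![0, 0, 0, 0, 1, 0, 0, 0] d = 0)
    (h6 : polar (minusForm a m) ![0, 0, 0, 0, 0, 1, 0, 0] d = 0) : d = 0 := by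
  simp [polar_minusForm] at h1 h2 h3 h4 h5 h6
  rw [minusForm_apply] at h0
  obtain ⟨h7, h8⟩ := hE (d 6) (d 7) (by
    rw [h1, h2, h3] at h0
    linear_combination h0)
  ext i
  fin_cases i
  exacts [h4, h5, h6, h1, h2, h3, h7, h8]

theorem isometryGroup_minusForm_le {a m : F}
    (hE : ∀ s t : F, a * (s * s) + m * (s * t) + a * (t * t) = 0 → s = 0 ∧ t = 0) :
    isometryGroup (minusForm a m) ≤ siegelReflSubgroup (minusForm a m) := by
  intro g hg
  have hfix : CanFix (minusForm a m) ∅ g := ⟨1, one_mem _, by simp⟩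
  have hfix1 := hfix.insert_pair (z := ![1, 0, 0, 0, 0, 0, 0, 0])
    (z' := ![0, 0, 0, 1, 0, 0, 0, 0]) (by simp [minusForm_apply]) (by simp [minusForm_apply])
    (by simp [polar_minusForm]) (by simp) (by simp) hg
  have hfix2 := hfix1.insert_pair (z := ![0, 1, 0, 0, 0, 0, 0, 0])
    (z' := ![0, 0, 0, 0, 1, 0, 0, 0]) (by simp [minusForm_apply]) (by simp [minusForm_apply])
    (by simp [polar_minusForm]) (by simp [polar_minusForm]) (by simp [polar_minusForm]) hg
  have hfix3 := hfix2.insert_pair (z := ![0, 0, 1, 0, 0, 0, 0, 0])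
    (z' := ![0, 0, 0, 0, 0, 1, 0, 0]) (by simp [minusForm_apply]) (by simp [minusForm_apply])
    (by simp [polar_minusForm]) (by simp [polar_minusForm]) (by simp [polar_minusForm]) hg
  have key : ∀ (P : Set (Fin 8 → F)) (u : Fin 8 → F),
      (insert ![0, 0, 1, 0, 0, 0, 0, 0] (insert ![0, 0, 0, 0, 0, 1, 0, 0]
        (insert ![0, 1, 0, 0, 0, 0, 0, 0] (insert ![0, 0, 0, 0, 1, 0, 0, 0]
        (insert ![1, 0, 0, 0, 0, 0, 0, 0] (insert ![0, 0, 0, 1, 0, 0, 0, 0] ∅)))))) ⊆ P →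
      ∀ k ∈ isometryGroup (minusForm a m), (∀ p ∈ P, k p = p) →
        k u = u ∨ minusForm a m (k u - u) ≠ 0 := by
    intro P u hP k hk hkP
    by_cases h0 : minusForm a m (k u - u) = 0
    · left
      have horth : ∀ p ∈ P, polar (minusForm a m) p (k u - u) = 0 := fun p hp => by
        have h := polar_isometry hk p u
        rw [hkP p hp] at h
        rw [QuadraticMap.polar_sub_right, h, sub_self]
      have h1 := horth ![0, 0, 1, 0, 0, 0, 0, 0] (hP (by simp))
      have h2 := horth ![0, 0, 0, 0, 0, 1, 0, 0] (hP (by simp))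
      have h3 := horth ![0, 1, 0, 0, 0, 0, 0, 0] (hP (by simp))
      have h4 := horth ![0, 0, 0, 0, 1, 0, 0, 0] (hP (by simp))
      have h5 := horth ![1, 0, 0, 0, 0, 0, 0, 0] (hP (by simp))
      have h6 := horth ![0, 0, 0, 1, 0, 0, 0, 0] (hP (by simp))
      exact sub_eq_zero.1 (eq_zero_of_orthogonal_pairs hE h0 h5 h3 h1 h6 h4 h2)
    · exact Or.inr h0
  have hfix4 := hfix3.insert_of_anisotropic (u := ![0, 0, 0, 0, 0, 0, 1, 0])
    (key _ _ subset_rfl) hg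
  obtain ⟨k, hk, hkP⟩ := hfix4.insert_of_anisotropic (u := ![0, 0, 0, 0, 0, 0, 0, 1])
    (key _ _ (Set.subset_insert _ _)) hg
  have h1 : k * g = 1 := by
    ext1 v
    have hv : v = v 0 • ![1, 0, 0, 0, 0, 0, 0, 0] + v 1 • ![0, 1, 0, 0, 0, 0, 0, 0] +
        v 2 • ![0, 0, 1, 0, 0, 0, 0, 0] + v 3 • ![0, 0, 0, 1, 0, 0, 0, 0] +
        v 4 • ![0, 0, 0, 0, 1, 0, 0, 0] + v 5 • ![0, 0, 0, 0, 0, 1, 0, 0] +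
        v 6 • ![0, 0, 0, 0, 0, 0, 1, 0] + v 7 • ![0, 0, 0, 0, 0, 0, 0, 1] := by
      ext i
      fin_cases i <;> simp
    change k (g v) = v
    rw [hv]
    simp only [map_add, map_smul]
    congr <;> exact hkP _ (by simp)
  rw [eq_inv_of_mul_eq_one_right h1]
  exact inv_mem hk

end MinusForm

section Powers

variable {F V : Type*} [Field F] [AddCommGroup V] [Module F V]

theorem exists_pow_eq_one_of_squarefree (p : ℕ) [Fact p.Prime] [CharP F p] {s : V ≃ₗ[F] V}
    (hs : IsOfFinOrder s) {P : Polynomial F} (hP : Squarefree P)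
    (hPs : Polynomial.aeval (s : Module.End F V) P = 0) : ∃ N : ℕ, (N : F) ≠ 0 ∧ s ^ N = 1 := by
  have hp : p.Prime := Fact.out
  obtain ⟨k, N, hN, hkN⟩ :=
    Nat.exists_eq_pow_mul_and_not_dvd hs.orderOf_pos.ne' p hp.ne_one
  refine ⟨N, fun h => hN ((CharP.cast_eq_zero_iff F p N).1 h), ?_⟩
  have hcoe (n : ℕ) : ((s ^ n : V ≃ₗ[F] V) : Module.End F V) = (s : Module.End F V) ^ n := by
    induction n with
    | zero => rfl
    | succ n ih => rw [pow_succ, pow_succ, ← ih]; rfl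
  have h1 : minpoly F (s : Module.End F V) ∣ (Polynomial.X ^ N - 1) ^ p ^ k := by
    refine minpoly.dvd F _ ?_
    rw [sub_pow_char_pow, ← pow_mul, mul_comm N, ← hkN, one_pow, map_sub, map_pow,
      Polynomial.aeval_X, ← hcoe, pow_orderOf_eq_one, map_one]
    exact sub_self _
  have h2 : minpoly F (s : Module.End F V) ∣ Polynomial.X ^ N - 1 :=
    ((hP.squarefree_of_dvd (minpoly.dvd F _ hPs)).dvd_pow_iff_dvd
      (pow_pos hp.pos k).ne').1 h1
  obtain ⟨R, hR⟩ := h2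
  have h3 := congrArg (Polynomial.aeval (s : Module.End F V)) hR
  rw [map_mul, minpoly.aeval, zero_mul, map_sub, map_pow, Polynomial.aeval_X, map_one, ← hcoe,
    sub_eq_zero] at h3
  exact LinearEquiv.toLinearMap_injective h3

variable {Q : QuadraticForm F V}

theorem siegelEquiv_pow_apply {e w : V} (he : Q e = 0) (hw : polar Q e w = 0) (n : ℕ) (v : V) :
    (siegelEquiv he hw ^ n) v = siegelMap Q e ((n : F) • w) v := by
  induction n with
  | zero => simp [siegelMap_zero]
  | succ n ih =>
    rw [pow_succ', LinearEquiv.mul_apply, ih, siegelEquiv_apply, siegelMap_add he hw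
      (by rw [QuadraticMap.polar_smul_right, hw, smul_zero])]
    congr 2
    push_cast
    module

theorem SiegelMem.nsmul {H : Subgroup (V ≃ₗ[F] V)} {e w : V} (h : SiegelMem Q H e w) (n : ℕ) :
    SiegelMem Q H e ((n : F) • w) := by
  induction n with
  | zero => simpa using SiegelMem.zero h.1
  | succ n ih =>
    refine (ih.add h).congr rfl ?_
    push_cast
    module

theorem SiegelMem.of_natCast_smul [Finite F] {H : Subgroup (V ≃ₗ[F] V)} {e w : V} {n : ℕ}
    (hn : (n : F) ≠ 0) (h : SiegelMem Q H e ((n : F) • w)) : SiegelMem Q H e w := by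
  have := Fintype.ofFinite F
  have h1 := h.nsmul (n ^ (Fintype.card F - 2))
  refine h1.congr rfl ?_
  have h2 : 2 ≤ Fintype.card F := Fintype.one_lt_card
  rw [smul_smul, Nat.cast_pow, ← pow_succ, show Fintype.card F - 2 + 1 = Fintype.card F - 1 by
    omega, FiniteField.pow_card_sub_one_eq_one _ hn, one_smul]

end Powers

section LongRoot

variable {F : Type*} [Field F]

/-- The long root element through which the product of the generators degenerates. -/
def rootEquiv (a m : F) : (Fin 8 → F) ≃ₗ[F] (Fin 8 → F) :=
  siegelEquiv (Q := minusForm a m) (e := ![1, 0, 0, 0, 0, 0, 0, 0])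
    (w := ![0, 0, 0, 0, 1, 0, 0, 0]) (by simp [minusForm_apply]) (by simp [polar_minusForm])

theorem rootEquiv_apply (a m : F) (v : Fin 8 → F) :
    rootEquiv a m v = ![v 0 - v 1, v 1, v 2, v 3, v 4 + v 3, v 5, v 6, v 7] := by
  ext i
  rw [rootEquiv, siegelEquiv_apply, siegelMap_minusForm]
  fin_cases i <;> simp [polar_minusForm, minusForm_apply]

theorem commute_rootEquiv (a m c t : F) :
    Commute (involEquiv a m c t * cycleEquiv F) (rootEquiv a m) := by
  ext v i
  simp only [LinearEquiv.mul_apply, rootEquiv_apply, cycleEquiv_apply, involEquiv_apply]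
  fin_cases i <;> simp <;> ring

/-- The polynomial annihilating the product of the generators and the root element. -/
noncomputable def annihilator (a m c : F) : Polynomial F :=
  (Polynomial.X ^ 2 - Polynomial.C c * Polynomial.X + 1) *
    (Polynomial.X ^ 4 + Polynomial.C a * Polynomial.X ^ 3 +
      Polynomial.C (m - 2) * Polynomial.X ^ 2 + Polynomial.C a * Polynomial.X + 1)

/-- The sum of `s` and its inverse, where `s` is the product of the generators and the root
element. -/
def traceMap (a m c t : F) (v : Fin 8 → F) : Fin 8 → F :=
  ![c * v 0 - (c + a) * v 1 + c * v 2 + 2 * v 3 + (t - c ^ 2) * v 5 + 2 * a * v 6 + m * v 7,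
    c * v 1,
    c * v 1 - a * v 2 + (t - c ^ 2) * v 3 + 2 * v 5 + 2 * a * v 6 + m * v 7,
    c * v 3,
    2 * v 1 + (m - t) * v 2 - (a + c) * v 3 + c * v 4 + c * v 5 - m * v 6 - 2 * a * v 7,
    2 * v 2 + (m - t) * v 1 - a * v 5 + c * v 3 - m * v 6 - 2 * a * v 7,
    v 3 + v 5 + 2 * v 7,
    2 * v 6 - v 1 - v 2]

theorem apply_traceMap (a m c t : F) (v : Fin 8 → F) :
    (involEquiv a m c t * cycleEquiv F * rootEquiv a m) (traceMap a m c t v) =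
      (involEquiv a m c t * cycleEquiv F * rootEquiv a m)
        ((involEquiv a m c t * cycleEquiv F * rootEquiv a m) v) + v := by
  ext i
  simp only [LinearEquiv.mul_apply, rootEquiv_apply, cycleEquiv_apply, involEquiv_apply,
    Pi.add_apply]
  fin_cases i <;> simp [traceMap] <;> ring

theorem traceMap_relation {a m c t : F}
    (h : 8 * c * a + 4 * c ^ 2 - 2 * c ^ 2 * t + 2 * c ^ 2 * m + 2 * a ^ 2 - 8 - 2 * t * m +
      2 * t ^ 2 + 4 * m = 0)
    (h' : -c * a ^ 2 + 4 * c + c * t * m - c * t ^ 2 - 2 * c * m - 4 * c ^ 2 * a - 2 * c ^ 3 +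
      c ^ 3 * t - c ^ 3 * m = 0) (v : Fin 8 → F) :
    traceMap a m c t (traceMap a m c t (traceMap a m c t v - c • v)) +
      a • traceMap a m c t (traceMap a m c t v - c • v) +
      (m - 4) • (traceMap a m c t v - c • v) = 0 := by
  obtain ⟨u, hu, h0, h1, h2, h3, h4, h5, h6, h7⟩ : ∃ u : Fin 8 → F,
      u = traceMap a m c t v - c • v ∧ u 0 = - (c + a) * v 1 + c * v 2 + 2 * v 3 +
        (t - c ^ 2) * v 5 + 2 * a * v 6 + m * v 7 ∧ u 1 = 0 ∧
      u 2 = c * v 1 - (a + c) * v 2 + (t - c ^ 2) * v 3 + 2 * v 5 + 2 * a * v 6 + m * v 7 ∧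
      u 3 = 0 ∧
      u 4 = 2 * v 1 + (m - t) * v 2 - (a + c) * v 3 + c * v 5 - m * v 6 - 2 * a * v 7 ∧
      u 5 = 2 * v 2 + (m - t) * v 1 - (a + c) * v 5 + c * v 3 - m * v 6 - 2 * a * v 7 ∧
      u 6 = v 3 + v 5 + 2 * v 7 - c * v 6 ∧ u 7 = 2 * v 6 - v 1 - v 2 - c * v 7 := by
    refine ⟨_, rfl, ?_⟩
    simp only [Pi.sub_apply, Pi.smul_apply, traceMap, smul_eq_mul]
    simp
    refine ⟨?_, ?_, ?_, ?_⟩ <;> ring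
  rw [← hu]
  ext i
  fin_cases i <;> simp [traceMap, h0, h1, h2, h3, h4, h5, h6, h7]
  · linear_combination v 3 * h + v 1 * h'
  · ring
  · linear_combination v 1 * h + v 3 * h'
  · ring
  · ring
  · ring

theorem aeval_annihilator {a m c t : F}
    (h : 8 * c * a + 4 * c ^ 2 - 2 * c ^ 2 * t + 2 * c ^ 2 * m + 2 * a ^ 2 - 8 - 2 * t * m +
      2 * t ^ 2 + 4 * m = 0)
    (h' : -c * a ^ 2 + 4 * c + c * t * m - c * t ^ 2 - 2 * c * m - 4 * c ^ 2 * a - 2 * c ^ 3 +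
      c ^ 3 * t - c ^ 3 * m = 0) :
    Polynomial.aeval ((involEquiv a m c t * cycleEquiv F * rootEquiv a m :
      (Fin 8 → F) ≃ₗ[F] (Fin 8 → F)) : Module.End F (Fin 8 → F)) (annihilator a m c) = 0 := by
  have hs := apply_traceMap a m c t
  have hrel := traceMap_relation h h'
  generalize involEquiv a m c t * cycleEquiv F * rootEquiv a m = s at hs ⊢
  generalize traceMap a m c t = D at hs hrel
  refine LinearMap.ext fun v => ?_
  have hv : s (s v) - c • s v + v = s (D v - c • v) := by
    rw [map_sub, hs, map_smul]
    abel
  have hu := congrArg (fun x => s (s (s x))) (hrel v)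
  generalize D v - c • v = u at hu hv
  simp only [map_add, map_smul, hs, map_zero] at hu
  rw [annihilator, mul_comm, map_mul, Module.End.mul_apply]
  have h1 : Polynomial.aeval (s : Module.End F (Fin 8 → F))
      (Polynomial.X ^ 2 - Polynomial.C c * Polynomial.X + 1) v = s u := by
    rw [← hv]
    simp [pow_two]
  rw [h1]
  have h2 : ∀ z, Polynomial.aeval (s : Module.End F (Fin 8 → F))
      (Polynomial.X ^ 4 + Polynomial.C a * Polynomial.X ^ 3 +
      Polynomial.C (m - 2) * Polynomial.X ^ 2 + Polynomial.C a * Polynomial.X + 1) z =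
      s (s (s (s z))) + a • s (s (s z)) + (m - 2) • s (s z) + a • s z + z := fun z => by
    simp only [map_add, map_mul, map_pow, Polynomial.aeval_X, Polynomial.aeval_C, map_one]
    rfl
  rw [h2, LinearMap.zero_apply, ← hu]
  module

theorem exists_pow_mul_rootEquiv_pow [Finite F] {a m c t : F}
    (h : 8 * c * a + 4 * c ^ 2 - 2 * c ^ 2 * t + 2 * c ^ 2 * m + 2 * a ^ 2 - 8 - 2 * t * m +
      2 * t ^ 2 + 4 * m = 0)
    (h' : -c * a ^ 2 + 4 * c + c * t * m - c * t ^ 2 - 2 * c * m - 4 * c ^ 2 * a - 2 * c ^ 3 +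
      c ^ 3 * t - c ^ 3 * m = 0) (hP : Squarefree (annihilator a m c)) :
    ∃ N : ℕ, (N : F) ≠ 0 ∧
      (involEquiv a m c t * cycleEquiv F) ^ N * rootEquiv a m ^ N = 1 := by
  have : Finite ((Fin 8 → F) ≃ₗ[F] (Fin 8 → F)) :=
    Finite.of_injective (fun g => (g : (Fin 8 → F) → (Fin 8 → F))) DFunLike.coe_injective
  obtain ⟨p, hp⟩ := CharP.exists F
  have : Fact p.Prime := ⟨(CharP.char_is_prime_or_zero F p).resolve_right
    (CharP.char_ne_zero_of_finite F p)⟩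
  obtain ⟨N, hN, hsN⟩ := exists_pow_eq_one_of_squarefree p
    (isOfFinOrder_of_finite (involEquiv a m c t * cycleEquiv F * rootEquiv a m)) hP
    (aeval_annihilator h h')
  exact ⟨N, hN, by rw [← hsN, (commute_rootEquiv a m c t).mul_pow]⟩

theorem siegelMem_of_pow [Finite F] {a m : F} {H : Subgroup ((Fin 8 → F) ≃ₗ[F] (Fin 8 → F))}
    {w : (Fin 8 → F) ≃ₗ[F] (Fin 8 → F)} (hw : w ∈ H) {N : ℕ} (hN : (N : F) ≠ 0)
    (h : w ^ N * rootEquiv a m ^ N = 1) :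
    SiegelMem (minusForm a m) H ![1, 0, 0, 0, 0, 0, 0, 0] ![0, 0, 0, 0, 1, 0, 0, 0] := by
  refine SiegelMem.of_natCast_smul hN ⟨by simp [minusForm_apply], by simp [polar_minusForm],
    rootEquiv a m ^ N, ?_, siegelEquiv_pow_apply _ _ N⟩
  rw [eq_inv_of_mul_eq_one_right h]
  exact inv_mem (pow_mem hw N)

end LongRoot

section Squarefree

open Polynomial

variable {F : Type*} [Field F]

theorem isCoprime_of_combination {f g u v : F[X]} {k : F} (hk : k ≠ 0)
    (h : u * f + v * g = C k) : IsCoprime f g := by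
  refine ⟨C k⁻¹ * u, C k⁻¹ * v, ?_⟩
  have h1 : C k⁻¹ * C k = 1 := by rw [← C_mul, inv_mul_cancel₀ hk, C_1]
  linear_combination C k⁻¹ * h + h1

theorem squarefree_annihilator_odd {a : F} (h2 : (2 : F) ≠ 0) (ha : a ≠ 0) (ha8 : a - 8 ≠ 0)
    (ha1 : a + 1 ≠ 0) : Squarefree (annihilator a (2 * a + 4) 0) := by
  refine Separable.squarefree (Separable.mul ?_ ?_ ?_)
  · refine isCoprime_of_combination (u := 2) (v := -X) (k := 2) h2 ?_
    simp only [derivative_add, derivative_sub, derivative_mul, derivative_X_pow, derivative_C,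
      derivative_X, derivative_one]
    push_cast
    simp only [C_0, C_ofNat]
    ring
  · refine isCoprime_of_combination
      (u := C a * (512 + 432 * C a - 54 * C a ^ 2 - C a ^ 3) +
        C a * (256 + 224 * C a - 8 * C a ^ 2 - 3 * C a ^ 3) * X +
        (256 + 352 * C a - 16 * C a ^ 2 - 4 * C a ^ 3) * X ^ 2)
      (v := C a * (-48 - 66 * C a + 9 * C a ^ 2) +
        (-64 - 280 * C a - 196 * C a ^ 2 + 21 * C a ^ 3 + C a ^ 4) * X +
        C a * (-80 - 78 * C a + 3 * C a ^ 2 + C a ^ 3) * X ^ 2 +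
        (-64 - 88 * C a + 4 * C a ^ 2 + C a ^ 3) * X ^ 3)
      (k := 2 ^ 3 * (a + 1) * a * (a - 8) ^ 2)
      (mul_ne_zero (mul_ne_zero (mul_ne_zero (pow_ne_zero 3 h2) ha1) ha) (pow_ne_zero 2 ha8)) ?_
    simp only [derivative_add, derivative_mul, derivative_X_pow, derivative_C,
      derivative_X, derivative_one]
    push_cast
    simp only [C_mul, C_add, C_sub, C_pow, C_ofNat, C_1]
    ring
  · refine isCoprime_of_combination (u := X ^ 2 + C a * X + 2 * C a + 1) (v := -1) (k := 2 * a)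
      (mul_ne_zero h2 ha) ?_
    simp only [C_mul, C_add, C_sub, C_ofNat, C_0]
    ring

theorem squarefree_annihilator_even {a : F} (h2 : (2 : F) = 0) (ha : a ≠ 0) :
    Squarefree (annihilator a 1 1) := by
  have h2' : (2 : F[X]) = 0 := by rw [← C_ofNat, h2, C_0]
  refine Separable.squarefree (Separable.mul ?_ ?_ ?_)
  · refine isCoprime_of_combination (u := 0) (v := -1) (k := 1) one_ne_zero ?_
    simp only [derivative_add, derivative_sub, derivative_mul, derivative_X_pow, derivative_C,
      derivative_X, derivative_one]
    push_cast
    simp only [C_1, C_ofNat]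
    linear_combination -X * h2'
  · refine isCoprime_of_combination (u := C a) (v := X ^ 2 + C a * X) (k := a) ha ?_
    simp only [derivative_add, derivative_mul, derivative_X_pow, derivative_C,
      derivative_X, derivative_one]
    push_cast
    simp only [C_sub, C_ofNat, C_1]
    linear_combination (C a * X ^ 4 * 4 + C a ^ 2 * X ^ 3 * 2 + C a ^ 2 * X + 2 * X ^ 5 -
      C a * X ^ 2 - X ^ 3) * h2'
  · refine isCoprime_of_combination (u := C a + X * (X ^ 2 + (C a + 1) * X + (C a + 1)))
      (v := -X) (k := a) ha ?_
    simp only [C_sub, C_ofNat, C_1]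
    linear_combination X ^ 3 * h2'

end Squarefree

section RootElements

variable {F V : Type*} [Field F] [AddCommGroup V] [Module F V]

theorem SiegelMem.swap_smul {Q : QuadraticForm F V} {H : Subgroup (V ≃ₗ[F] V)} {e w : V} {s : F}
    (h : SiegelMem Q H e (s • w)) (hw : Q w = 0) : SiegelMem Q H w (-s • e) := by
  by_cases hs : s = 0
  · rw [hs, neg_zero, zero_smul]
    exact SiegelMem.zero hw
  · refine (SiegelMem.of_smul hs (h.swap (by rw [QuadraticMap.map_smul, hw, smul_zero]))).congr
      rfl (by module)

variable {a m : F} {H : Subgroup ((Fin 8 → F) ≃ₗ[F] (Fin 8 → F))}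

/-- The Siegel transformations with parameter `s` attached to the roots of the linear group
acting on the totally singular subspace spanned by the first three coordinates. -/
structure RootElements (a m : F) (H : Subgroup ((Fin 8 → F) ≃ₗ[F] (Fin 8 → F))) (s : F) :
    Prop where
  e1f2 : SiegelMem (minusForm a m) H ![1, 0, 0, 0, 0, 0, 0, 0] ![0, 0, 0, 0, s, 0, 0, 0]
  e1f3 : SiegelMem (minusForm a m) H ![1, 0, 0, 0, 0, 0, 0, 0] ![0, 0, 0, 0, 0, s, 0, 0]
  e2f1 : SiegelMem (minusForm a m) H ![0, 1, 0, 0, 0, 0, 0, 0] ![0, 0, 0, s, 0, 0, 0, 0]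
  e2f3 : SiegelMem (minusForm a m) H ![0, 1, 0, 0, 0, 0, 0, 0] ![0, 0, 0, 0, 0, s, 0, 0]
  e3f1 : SiegelMem (minusForm a m) H ![0, 0, 1, 0, 0, 0, 0, 0] ![0, 0, 0, s, 0, 0, 0, 0]
  e3f2 : SiegelMem (minusForm a m) H ![0, 0, 1, 0, 0, 0, 0, 0] ![0, 0, 0, 0, s, 0, 0, 0]
  f1e2 : SiegelMem (minusForm a m) H ![0, 0, 0, 1, 0, 0, 0, 0] ![0, s, 0, 0, 0, 0, 0, 0]
  f1e3 : SiegelMem (minusForm a m) H ![0, 0, 0, 1, 0, 0, 0, 0] ![0, 0, s, 0, 0, 0, 0, 0]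
  f2e1 : SiegelMem (minusForm a m) H ![0, 0, 0, 0, 1, 0, 0, 0] ![s, 0, 0, 0, 0, 0, 0, 0]
  f2e3 : SiegelMem (minusForm a m) H ![0, 0, 0, 0, 1, 0, 0, 0] ![0, 0, s, 0, 0, 0, 0, 0]

theorem SiegelMem.conj_cycle (hH : H ≤ isometryGroup (minusForm a m)) (hy : cycleEquiv F ∈ H)
    {u₀ u₁ u₂ u₃ u₄ u₅ u₆ u₇ v₀ v₁ v₂ v₃ v₄ v₅ v₆ v₇ : F}
    (h : SiegelMem (minusForm a m) H ![u₀, u₁, u₂, u₃, u₄, u₅, u₆, u₇]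
      ![v₀, v₁, v₂, v₃, v₄, v₅, v₆, v₇]) :
    SiegelMem (minusForm a m) H ![u₂, u₀, u₁, u₅, u₃, u₄, u₆, u₇]
      ![v₂, v₀, v₁, v₅, v₃, v₄, v₆, v₇] :=
  h.conj hH hy

theorem rootElements_of (hH : H ≤ isometryGroup (minusForm a m)) (hy : cycleEquiv F ∈ H) {s : F}
    (h : SiegelMem (minusForm a m) H ![1, 0, 0, 0, 0, 0, 0, 0] ![0, 0, 0, 0, s, 0, 0, 0])
    (h' : SiegelMem (minusForm a m) H ![1, 0, 0, 0, 0, 0, 0, 0] ![0, 0, 0, 0, 0, s, 0, 0]) :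
    RootElements a m H s := by
  have h2 := h.conj_cycle hH hy
  have h3 := h2.conj_cycle hH hy
  have h2' := h'.conj_cycle hH hy
  have h3' := h2'.conj_cycle hH hy
  have hswap : ∀ u v : Fin 8 → F, minusForm a m v = 0 →
      SiegelMem (minusForm a m) H u (s • v) → SiegelMem (minusForm a m) H v (s • u) :=
    fun u v hv huv => (huv.swap_smul hv).neg.congr rfl (by module)
  refine ⟨h, h', h2', h2, h3, h3', ?_, ?_, ?_, ?_⟩
  · refine (hswap ![0, 1, 0, 0, 0, 0, 0, 0] ![0, 0, 0, 1, 0, 0, 0, 0]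
      (by simp [minusForm_apply]) (by simpa using h2')).congr rfl (by simp)
  · refine (hswap ![0, 0, 1, 0, 0, 0, 0, 0] ![0, 0, 0, 1, 0, 0, 0, 0]
      (by simp [minusForm_apply]) (by simpa using h3)).congr rfl (by simp)
  · refine (hswap ![1, 0, 0, 0, 0, 0, 0, 0] ![0, 0, 0, 0, 1, 0, 0, 0]
      (by simp [minusForm_apply]) (by simpa using h)).congr rfl (by simp)
  · refine (hswap ![0, 0, 1, 0, 0, 0, 0, 0] ![0, 0, 0, 0, 1, 0, 0, 0]
      (by simp [minusForm_apply]) (by simpa using h3')).congr rfl (by simp)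

/-- The parameters of the root elements form a subring. -/
theorem exists_rootSubring (hH : H ≤ isometryGroup (minusForm a m)) (hy : cycleEquiv F ∈ H)
    (h : SiegelMem (minusForm a m) H ![1, 0, 0, 0, 0, 0, 0, 0] ![0, 0, 0, 0, 1, 0, 0, 0]) :
    ∃ R : Subring F, (∀ s ∈ R, RootElements a m H s) ∧ ∀ s,
      (SiegelMem (minusForm a m) H ![1, 0, 0, 0, 0, 0, 0, 0] ![0, 0, 0, 0, s, 0, 0, 0] ∨
      SiegelMem (minusForm a m) H ![1, 0, 0, 0, 0, 0, 0, 0] ![0, 0, 0, 0, 0, s, 0, 0]) →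
      s ∈ R := by
  have hprod : ∀ s r : F,
      SiegelMem (minusForm a m) H ![1, 0, 0, 0, 0, 0, 0, 0] ![0, 0, 0, 0, s, 0, 0, 0] →
      SiegelMem (minusForm a m) H ![1, 0, 0, 0, 0, 0, 0, 0] ![0, 0, 0, 0, r, 0, 0, 0] →
      SiegelMem (minusForm a m) H ![1, 0, 0, 0, 0, 0, 0, 0] ![0, 0, 0, 0, 0, s * r, 0, 0] := by
    intro s r hs hr
    refine ((hs.conj_siegel hH (hr.conj_cycle hH hy)).sub (hs.congr ?_ rfl)).congr ?_ ?_ <;>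
    · ext i
      fin_cases i <;> simp [siegelMap_minusForm, polar_minusForm, minusForm_apply]
  have hprod' : ∀ s r : F,
      SiegelMem (minusForm a m) H ![1, 0, 0, 0, 0, 0, 0, 0] ![0, 0, 0, 0, 0, s, 0, 0] →
      SiegelMem (minusForm a m) H ![1, 0, 0, 0, 0, 0, 0, 0] ![0, 0, 0, 0, 0, r, 0, 0] →
      SiegelMem (minusForm a m) H ![1, 0, 0, 0, 0, 0, 0, 0] ![0, 0, 0, 0, s * r, 0, 0, 0] := by
    intro s r hs hr
    refine ((hs.conj_siegel hH ((hr.conj_cycle hH hy).conj_cycle hH hy)).sub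
      (hs.congr ?_ rfl)).congr ?_ ?_ <;>
    · ext i
      fin_cases i <;> simp [siegelMap_minusForm, polar_minusForm, minusForm_apply]
  have hto : ∀ s : F,
      SiegelMem (minusForm a m) H ![1, 0, 0, 0, 0, 0, 0, 0] ![0, 0, 0, 0, s, 0, 0, 0] →
      SiegelMem (minusForm a m) H ![1, 0, 0, 0, 0, 0, 0, 0] ![0, 0, 0, 0, 0, s, 0, 0] := by
    intro s hs
    simpa using hprod s 1 hs h
  have hfrom : ∀ s : F,
      SiegelMem (minusForm a m) H ![1, 0, 0, 0, 0, 0, 0, 0] ![0, 0, 0, 0, 0, s, 0, 0] →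
      SiegelMem (minusForm a m) H ![1, 0, 0, 0, 0, 0, 0, 0] ![0, 0, 0, 0, s, 0, 0, 0] := by
    intro s hs
    simpa using hprod' s 1 hs (hto 1 h)
  refine ⟨{ carrier := {s | SiegelMem (minusForm a m) H ![1, 0, 0, 0, 0, 0, 0, 0]
              ![0, 0, 0, 0, s, 0, 0, 0]}
            mul_mem' := fun {s r} hs hr => hfrom _ (hprod s r hs hr)
            one_mem' := h
            add_mem' := fun {s r} hs hr => (hs.add hr).congr rfl (by simp)
            zero_mem' := (SiegelMem.zero h.1).congr rfl (by
              ext i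
              fin_cases i <;> rfl)
            neg_mem' := fun {s} hs => hs.neg.congr rfl (by simp) },
    fun s hs => rootElements_of hH hy hs (hto s hs), fun s hs => hs.elim id (hfrom s)⟩

/-- Enough root elements give all Siegel transformations. -/
theorem siegelSubgroup_le_of_rootElements (hH : H ≤ isometryGroup (minusForm a m))
    (hy : cycleEquiv F ∈ H) (h : ∀ s, RootElements a m H s)
    (hnd : ∀ u : Fin 8 → F, (∀ v, polar (minusForm a m) u v = 0) → u = 0)
    (hee : ∀ s, SiegelMem (minusForm a m) H ![1, 0, 0, 0, 0, 0, 0, 0] ![0, s, 0, 0, 0, 0, 0, 0])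
    (hff : ∀ s, SiegelMem (minusForm a m) H ![0, 0, 0, 1, 0, 0, 0, 0] ![0, 0, 0, 0, s, 0, 0, 0])
    (he : ∀ r s, SiegelMem (minusForm a m) H ![1, 0, 0, 0, 0, 0, 0, 0] ![0, 0, 0, 0, 0, 0, r, s])
    (hf : ∀ r s, SiegelMem (minusForm a m) H ![0, 0, 0, 1, 0, 0, 0, 0]
      ![0, 0, 0, 0, 0, 0, r, s]) :
    siegelSubgroup (minusForm a m) ≤ H := by
  have hee' : ∀ s,
      SiegelMem (minusForm a m) H ![1, 0, 0, 0, 0, 0, 0, 0] ![0, 0, s, 0, 0, 0, 0, 0] := by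
    intro s
    have h1 := ((hee s).conj_cycle hH hy).conj_cycle hH hy
    have h2 : SiegelMem (minusForm a m) H ![0, 0, 1, 0, 0, 0, 0, 0]
        (s • ![1, 0, 0, 0, 0, 0, 0, 0]) := h1.congr rfl (by simp)
    exact (h2.swap_smul (by simp [minusForm_apply])).neg.congr rfl (by simp)
  have hff' : ∀ s,
      SiegelMem (minusForm a m) H ![0, 0, 0, 1, 0, 0, 0, 0] ![0, 0, 0, 0, 0, s, 0, 0] := by
    intro s
    have h1 := ((hff s).conj_cycle hH hy).conj_cycle hH hy
    have h2 : SiegelMem (minusForm a m) H ![0, 0, 0, 0, 0, 1, 0, 0]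
        (s • ![0, 0, 0, 1, 0, 0, 0, 0]) := h1.congr rfl (by simp)
    exact (h2.swap_smul (by simp [minusForm_apply])).neg.congr rfl (by simp)
  have hE : FullSiegel (minusForm a m) H ![1, 0, 0, 0, 0, 0, 0, 0] := by
    intro w hw
    have hw3 : w 3 = 0 := by simpa [polar_minusForm] using hw
    refine (((((hee (w 1)).add (hee' (w 2))).add (h (w 4)).e1f2).add (h (w 5)).e1f3).add
      (he (w 6) (w 7))).add_self (w 0) |>.congr rfl ?_
    ext i
    fin_cases i <;> simp [hw3]
  have hF : FullSiegel (minusForm a m) H ![0, 0, 0, 1, 0, 0, 0, 0] := by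
    intro w hw
    have hw0 : w 0 = 0 := by simpa [polar_minusForm] using hw
    refine (((((hff (w 4)).add (hff' (w 5))).add (h (w 1)).f1e2).add (h (w 2)).f1e3).add
      (hf (w 6) (w 7))).add_self (w 3) |>.congr rfl ?_
    ext i
    fin_cases i <;> simp [hw0]
  have hcyc : ∀ u v : Fin 8 → F, cycleEquiv F u = v → FullSiegel (minusForm a m) H u →
      FullSiegel (minusForm a m) H v := by
    intro u v huv hu w hw
    have h1 : cycleEquiv F ((cycleEquiv F).symm w) = w := LinearEquiv.apply_symm_apply _ _
    have h2 := (hu ((cycleEquiv F).symm w) (by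
      rw [← hw, ← polar_isometry (cycleEquiv_mem a m), h1, huv])).conj hH hy
    rwa [h1, huv] at h2
  exact (twoHyperbolicPairs_minusForm a m).siegelSubgroup_le hH hE hF
    (hcyc _ _ rfl hE) (hcyc _ _ rfl hF) hnd

end RootElements

section Generation

variable {F : Type*} [Field F] {a m c t : F} {H : Subgroup ((Fin 8 → F) ≃ₗ[F] (Fin 8 → F))}

theorem SiegelMem.conj_invol (hH : H ≤ isometryGroup (minusForm a m))
    (hx : involEquiv a m c t ∈ H) {u v u' v' : Fin 8 → F} (h : SiegelMem (minusForm a m) H u v)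
    (hu : involEquiv a m c t u = u') (hv : involEquiv a m c t v = v') :
    SiegelMem (minusForm a m) H u' v' :=
  (h.conj hH hx).congr hu hv

theorem SiegelMem.conj_root (hH : H ≤ isometryGroup (minusForm a m))
    {u v u' v' e w : Fin 8 → F} (h : SiegelMem (minusForm a m) H u v)
    (h' : SiegelMem (minusForm a m) H e w) (hu : siegelMap (minusForm a m) e w u = u')
    (hv : siegelMap (minusForm a m) e w v = v') : SiegelMem (minusForm a m) H u' v' :=
  (h.conj_siegel hH h').congr hu hv

theorem SiegelMem.swap_vec {u v u' v' : Fin 8 → F} {s : F}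
    (h : SiegelMem (minusForm a m) H u v) (hv : v = s • v') (hv' : minusForm a m v' = 0)
    (hu : u' = -s • u) : SiegelMem (minusForm a m) H v' u' :=
  ((h.congr rfl hv).swap_smul hv').congr rfl hu.symm

theorem siegelMem_odd_of_root (hH : H ≤ isometryGroup (minusForm a m))
    (hx : involEquiv a m 0 t ∈ H) {s : F} (hs : RootElements a m H s) :
    SiegelMem (minusForm a m) H ![0, 0, 0, 0, 1, 0, 0, 0]
      ![s * t, 0, s, 0, 0, - (s * a), s, 0] := by
  have h1 := hs.e2f1.conj_invol hH hx (u' := (-1 : F) • ![0, 0, 0, 0, 1, 0, 0, 0])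
    (v' := ![s * t, 0, s, 0, 0, - (s * a), s, 0])
    (by ext i; fin_cases i <;> simp [involEquiv_apply])
    (by ext i; fin_cases i <;> simp [involEquiv_apply] <;> ring)
  exact (SiegelMem.of_smul (neg_ne_zero.2 one_ne_zero) h1).neg.congr rfl (by module)

theorem siegelMem_odd_sub (hH : H ≤ isometryGroup (minusForm a m))
    (hx : involEquiv a m 0 t ∈ H) (h : RootElements a m H 1) {s : F}
    (hs : RootElements a m H s) :
    SiegelMem (minusForm a m) H ![0, 0, 0, 0, 1, 0, 0, 0]
      ![s * t, 0, 0, 0, 0, - (s * a), 0, 0] := by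
  have h1 := siegelMem_odd_of_root hH hx hs
  have h2 : SiegelMem (minusForm a m) H ![0, 0, 0, 0, 1, 0, 0, 0]
      ![0, 0, - (s * t), - (s * a), 0, 0, 0, 0] := by
    refine ((h1.conj_root hH h.e3f1 (u' := ![0, 0, 0, 0, 1, 0, 0, 0]) ?_ rfl).sub h1).congr
      rfl ?_ <;>
    · ext i
      fin_cases i <;> simp [siegelMap_minusForm, polar_minusForm, minusForm_apply]
  refine ((h2.conj_root hH h.e1f3 (u' := ![0, 0, 0, 0, 1, 0, 0, 0]) ?_ rfl).sub h2).congr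
    rfl ?_ <;>
  · ext i
    fin_cases i <;> simp [siegelMap_minusForm, polar_minusForm, minusForm_apply]

theorem siegelMem_odd_mul (hH : H ≤ isometryGroup (minusForm a m))
    (hx : involEquiv a m 0 t ∈ H) (h : RootElements a m H 1) {s : F}
    (hs : RootElements a m H s) :
    SiegelMem (minusForm a m) H ![1, 0, 0, 0, 0, 0, 0, 0] ![0, 0, 0, 0, 0, s * t, 0, 0] := by
  have h3 := siegelMem_odd_sub hH hx h hs
  have h4 : SiegelMem (minusForm a m) H ![0, 0, 0, 0, 1, 1, 0, 0]
      ![s * t, 0, 0, 0, 0, - (s * a), 0, 0] := by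
    refine h3.conj_root hH h.e2f3 ?_ ?_ <;>
    · ext i
      fin_cases i <;> simp [siegelMap_minusForm, polar_minusForm, minusForm_apply]
  have hQ : minusForm a m ![s * t, 0, 0, 0, 0, - (s * a), 0, 0] = 0 := by simp [minusForm_apply]
  have h5 := ((h4.swap hQ).sub (h3.swap hQ)).swap_vec (s := 1)
    (v' := ![0, 0, 0, 0, 0, -1, 0, 0]) (by ext i; fin_cases i <;> simp) (by simp [minusForm_apply]) rfl
  have h6 := SiegelMem.of_smul (e := ![0, 0, 0, 0, 0, 1, 0, 0]) (neg_ne_zero.2 one_ne_zero)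
    (h5.congr (by simp) rfl)
  exact ((h6.add_self (s * a)).swap_vec (s := s * t) (v' := ![1, 0, 0, 0, 0, 0, 0, 0])
    (by simp) (by simp [minusForm_apply]) rfl).neg.congr rfl (by simp)

/-- In odd characteristic the two generators together with one root element generate all
Siegel transformations. -/
theorem siegelSubgroup_le_odd (hH : H ≤ isometryGroup (minusForm a m))
    (hx : involEquiv a m 0 (a + 2) ∈ H) (hy : cycleEquiv F ∈ H) (ha : a ≠ 0)
    (hclosure : Subring.closure {a + 1} = (⊤ : Subring F))
    (hnd : ∀ u : Fin 8 → F, (∀ v, polar (minusForm a m) u v = 0) → u = 0)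
    (hroot : SiegelMem (minusForm a m) H ![1, 0, 0, 0, 0, 0, 0, 0] ![0, 0, 0, 0, 1, 0, 0, 0]) :
    siegelSubgroup (minusForm a m) ≤ H := by
  obtain ⟨R, hR, hRmem⟩ := exists_rootSubring hH hy hroot
  have h1 := hR 1 R.one_mem
  have ht : a + 2 ∈ R := by simpa using hRmem _ (Or.inr (siegelMem_odd_mul hH hx h1 h1))
  have hRtop : R = ⊤ := by
    rw [eq_top_iff, ← hclosure, Subring.closure_le, Set.singleton_subset_iff]
    have h2 := R.sub_mem ht R.one_mem
    rwa [show a + 2 - 1 = a + 1 by ring] at h2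
  have hr : ∀ s, RootElements a m H s := fun s => hR s (hRtop ▸ Subring.mem_top s)
  have hf2f3 : ∀ s,
      SiegelMem (minusForm a m) H ![0, 0, 0, 0, 1, 0, 0, 0] ![0, 0, 0, 0, 0, s, 0, 0] := by
    intro s
    refine ((siegelMem_odd_sub hH hx h1 (hr (-s / a))).sub (hr (-s / a * (a + 2))).f2e1).congr
      rfl ?_
    ext i
    fin_cases i <;> simp [ha]
  have hff : ∀ s,
      SiegelMem (minusForm a m) H ![0, 0, 0, 1, 0, 0, 0, 0] ![0, 0, 0, 0, s, 0, 0, 0] :=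
    fun s => ((hf2f3 s).conj_cycle hH hy).conj_cycle hH hy
  have he2e1 : ∀ s,
      SiegelMem (minusForm a m) H ![0, 1, 0, 0, 0, 0, 0, 0] ![s, 0, 0, 0, 0, 0, 0, 0] := by
    intro s
    refine (SiegelMem.of_smul (neg_ne_zero.2 one_ne_zero)
      ((hf2f3 s).conj_invol hH hx (u' := (-1 : F) • ![0, 1, 0, 0, 0, 0, 0, 0]) ?_ rfl)).neg.congr
      rfl ?_ <;>
    · ext i
      fin_cases i <;> simp [involEquiv_apply]
  have hf2 : ∀ s,
      SiegelMem (minusForm a m) H ![0, 0, 0, 0, 1, 0, 0, 0] ![0, 0, 0, 0, 0, 0, s, 0] := by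
    intro s
    refine ((((siegelMem_odd_of_root hH hx (hr s)).sub (hr (s * (a + 2))).f2e1).sub
      (hr s).f2e3).sub (hf2f3 (-(s * a)))).congr rfl ?_
    ext i
    fin_cases i <;> simp
  have he1 : ∀ s,
      SiegelMem (minusForm a m) H ![1, 0, 0, 0, 0, 0, 0, 0] ![0, 0, 0, 0, 0, 0, 0, s] := by
    intro s
    refine (((((hf2 s).conj_cycle hH hy).conj_invol hH hx (u' := ![1, 0, 0, 0, 0, 0, 0, 0])
      ?_ rfl).add (hr (m * s)).e1f3).add_self (-(2 * a * s))).congr rfl ?_ <;>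
    · ext i
      fin_cases i <;> simp [involEquiv_apply]
  have hf2' : ∀ s,
      SiegelMem (minusForm a m) H ![0, 0, 0, 0, 1, 0, 0, 0] ![0, 0, 0, 0, 0, 0, 0, s] := by
    intro s
    have hs : SiegelMem (minusForm a m) H ![0, 0, 0, 0, 1, 0, 0, 0] ![0, 0, 0, s, 0, 0, 0, 0] :=
      (hff (-s)).swap_vec (s := -s) (by simp) (by simp [minusForm_apply]) (by simp)
    refine (((hs.conj_root hH (he1 1) (u' := ![0, 0, 0, 0, 1, 0, 0, 0]) ?_ rfl).sub hs).add
      (hr (a * s)).f2e1).congr rfl ?_ <;>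
    · ext i
      simp only [Pi.add_apply, Pi.sub_apply, siegelMap_minusForm]
      fin_cases i <;> simp [polar_minusForm, minusForm_apply]
  have he2' : ∀ s,
      SiegelMem (minusForm a m) H ![0, 1, 0, 0, 0, 0, 0, 0] ![0, 0, 0, 0, 0, 0, s, 0] := by
    intro s
    refine ((((he2e1 s).conj_root hH (((hf2 1).conj_cycle hH hy).conj_cycle hH hy)
      (u' := ![0, 1, 0, 0, 0, 0, 0, 0]) ?_ rfl).sub (he2e1 s)).add
      (hr (a * s)).e2f1).congr rfl ?_ <;>
    · ext i
      simp only [Pi.add_apply, Pi.sub_apply, siegelMap_minusForm]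
      fin_cases i <;> simp [polar_minusForm, minusForm_apply]
  refine siegelSubgroup_le_of_rootElements hH hy hr hnd
    (fun s => (he2e1 (-s)).swap_vec (s := -s) (by simp) (by simp [minusForm_apply]) (by simp))
    hff (fun r s => ?_) (fun r s => ?_)
  · exact ((((he2' r).conj_cycle hH hy).conj_cycle hH hy).add (he1 s)).congr rfl (by simp)
  · exact ((((hf2 r).add (hf2' s)).congr rfl (by simp)).conj_cycle hH hy).conj_cycle hH hy

end Generation

section GenerationCharTwo

variable {F : Type*} [Field F] {a : F} {H : Subgroup ((Fin 8 → F) ≃ₗ[F] (Fin 8 → F))}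

theorem siegelMem_even_of_root (h2 : (2 : F) = 0) (hH : H ≤ isometryGroup (minusForm a 1))
    (hx : involEquiv a 1 1 (a + 1) ∈ H) {s : F} (hs : RootElements a 1 H s) :
    SiegelMem (minusForm a 1) H ![1, 0, 0, 0, 1, 0, 0, 0]
      ![s * a, 0, s, 0, s, s * a, s, 0] := by
  refine hs.e2f1.conj_invol hH hx ?_ ?_ <;>
  · ext i
    fin_cases i <;> simp [involEquiv_apply] <;> grind

theorem siegelMem_even_mul (h2 : (2 : F) = 0) (hH : H ≤ isometryGroup (minusForm a 1))
    (hx : involEquiv a 1 1 (a + 1) ∈ H) (h : RootElements a 1 H 1) {s : F}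
    (hs : RootElements a 1 H s) :
    SiegelMem (minusForm a 1) H ![1, 0, 0, 0, 1, 0, 0, 0] ![0, 0, 0, 0, s * a, 0, 0, 0] := by
  have h1 := siegelMem_even_of_root h2 hH hx hs
  refine ((h1.conj_root hH h.e3f2 (u' := ![1, 0, 0, 0, 1, 0, 0, 0]) ?_ rfl).sub h1).congr
    rfl ?_ <;>
  · ext i
    simp only [Pi.sub_apply, siegelMap_minusForm]
    fin_cases i <;> simp [polar_minusForm, minusForm_apply]

theorem siegelMem_even_fst (h2 : (2 : F) = 0) (hH : H ≤ isometryGroup (minusForm a 1))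
    (hx : involEquiv a 1 1 (a + 1) ∈ H) (ha : a ≠ 0) (h : ∀ s, RootElements a 1 H s) (r s : F) :
    SiegelMem (minusForm a 1) H ![1, 0, 0, 0, 1, 0, 0, 0] ![r, 0, 0, 0, s, 0, 0, 0] := by
  refine ((siegelMem_even_mul h2 hH hx (h 1) (h ((s - r) / a))).add_self r).congr rfl ?_
  ext i
  fin_cases i <;> simp [ha]

theorem siegelMem_even_epsilon (h2 : (2 : F) = 0) (hH : H ≤ isometryGroup (minusForm a 1))
    (hx : involEquiv a 1 1 (a + 1) ∈ H) (ha : a ≠ 0) (h : ∀ s, RootElements a 1 H s) (s : F) :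
    SiegelMem (minusForm a 1) H ![1, 0, 0, 0, 1, 0, 0, 0] ![0, 0, s, 0, 0, s * a, s, 0] := by
  refine ((siegelMem_even_of_root h2 hH hx (h s)).sub
    (siegelMem_even_fst h2 hH hx ha h (s * a) s)).congr rfl ?_
  ext i
  fin_cases i <;> simp

theorem siegelMem_even_epsilon' (h2 : (2 : F) = 0) (hH : H ≤ isometryGroup (minusForm a 1))
    (hx : involEquiv a 1 1 (a + 1) ∈ H) (hy : cycleEquiv F ∈ H) (ha : a ≠ 0)
    (h : ∀ s, RootElements a 1 H s) (s : F) :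
    SiegelMem (minusForm a 1) H ![1, 0, 0, 0, 1, 0, 0, 0] ![0, 0, s * a, 0, 0, s, 0, s] := by
  have h1 : SiegelMem (minusForm a 1) H ![a, 1, 0, 1, 0, a, 0, 1]
      ![0, s, 0, 0, 0, s, 0, 0] := by
    refine (h s).e3f2.conj_invol hH hx ?_ ?_ <;>
    · ext i
      fin_cases i <;> simp [involEquiv_apply] <;> grind
  have h3 : SiegelMem (minusForm a 1) H ![0, 1, 0, 0, 0, 1, 0, 0]
      ![s * a, s, 0, s, 0, s * a, 0, s] := by
    refine h1.swap_vec (s := s) (by simp) (by simp [minusForm_apply]) ?_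
    ext i
    fin_cases i <;> simp <;> grind
  refine (((h3.conj_cycle hH hy).conj_cycle hH hy).sub
    (siegelMem_even_fst h2 hH hx ha h s (s * a))).congr rfl ?_
  ext i
  fin_cases i <;> simp

theorem siegelMem_even_transpose (h2 : (2 : F) = 0) (hH : H ≤ isometryGroup (minusForm a 1))
    (hx : involEquiv a 1 1 (a + 1) ∈ H) (ha : a ≠ 0) (h : ∀ s, RootElements a 1 H s) :
    SiegelMem (minusForm a 1) H ![1, 0, 0, 0, 0, 1, 0, 0] ![0, 1, 0, 0, a, 0, 1, 0] := by
  have h1 := siegelMem_even_epsilon h2 hH hx ha h 1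
  have h3 : SiegelMem (minusForm a 1) H ![1, 0, 0, 0, 1, 1, 0, 0] ![0, 1, 1, 0, 0, a, 1, 0] := by
    refine h1.conj_root hH (h 1).e2f3 ?_ ?_ <;>
    · ext i
      fin_cases i <;> simp [siegelMap_minusForm, polar_minusForm, minusForm_apply] <;> grind
  have h4 : SiegelMem (minusForm a 1) H ![1, 0, 0, 0, 0, 1, 0, 0] ![0, 1, 0, 0, a, a, 1, 0] := by
    refine h3.conj_root hH (h 1).e3f2 ?_ ?_ <;>
    · ext i
      fin_cases i <;> simp [siegelMap_minusForm, polar_minusForm, minusForm_apply] <;> grind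
  refine h4.conj_root hH (h 1).e2f3 ?_ ?_ <;>
  · ext i
    fin_cases i <;> simp [siegelMap_minusForm, polar_minusForm, minusForm_apply] <;> grind

theorem siegelMem_even_f2f1 (h2 : (2 : F) = 0) (hH : H ≤ isometryGroup (minusForm a 1))
    (hx : involEquiv a 1 1 (a + 1) ∈ H) (hy : cycleEquiv F ∈ H) (ha : a ≠ 0)
    (h : ∀ s, RootElements a 1 H s) (s : F) :
    SiegelMem (minusForm a 1) H ![0, 0, 0, 0, 1, 0, 0, 0] ![0, 0, 0, s * a ^ 2, 0, 0, 0, 0] := by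
  have h1 : SiegelMem (minusForm a 1) H ![1, 0, 0, 0, 1, 0, 0, 0]
      ![0, 0, 0, 0, 0, s * (1 + a ^ 2), s * a, s] := by
    refine ((siegelMem_even_epsilon h2 hH hx ha h (s * a)).add
      (siegelMem_even_epsilon' h2 hH hx hy ha h s)).congr rfl ?_
    ext i
    fin_cases i <;> simp <;> grind
  have h3 : SiegelMem (minusForm a 1) H ![0, 0, 0, 0, 1, 1, 0, 0]
      ![s, 0, 0, 0, 0, s * a ^ 2, s * a, s] := by
    refine h1.conj_root hH (siegelMem_even_transpose h2 hH hx ha h) ?_ ?_ <;>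
    · ext i
      fin_cases i <;> simp [siegelMap_minusForm, polar_minusForm, minusForm_apply] <;> grind
  have h4 : SiegelMem (minusForm a 1) H ![0, 0, 0, 0, 1, 0, 0, 0]
      ![s, 0, 0, 0, 0, s * a ^ 2, s * a, s] := by
    refine h3.conj_root hH (h 1).e2f3 ?_ ?_ <;>
    · ext i
      fin_cases i <;> simp [siegelMap_minusForm, polar_minusForm, minusForm_apply] <;> grind
  have h5 : SiegelMem (minusForm a 1) H ![0, 0, 0, 0, 1, 0, 0, 0]
      ![s, 0, s, s * a ^ 2, 0, s * a ^ 2, s * a, s] := by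
    refine h4.conj_root hH (h 1).e3f1 ?_ ?_ <;>
    · ext i
      fin_cases i <;> simp [siegelMap_minusForm, polar_minusForm, minusForm_apply] <;> grind
  refine ((h5.sub h4).sub (h s).f2e3).congr rfl ?_
  ext i
  fin_cases i <;> simp

/-- In characteristic two the two generators together with one root element generate all
Siegel transformations. -/
theorem siegelSubgroup_le_even (h2 : (2 : F) = 0) (hH : H ≤ isometryGroup (minusForm a 1))
    (hx : involEquiv a 1 1 (a + 1) ∈ H) (hy : cycleEquiv F ∈ H) (ha : a ≠ 0)
    (hclosure : Subring.closure {a} = (⊤ : Subring F))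
    (hnd : ∀ u : Fin 8 → F, (∀ v, polar (minusForm a 1) u v = 0) → u = 0)
    (hroot : SiegelMem (minusForm a 1) H ![1, 0, 0, 0, 0, 0, 0, 0] ![0, 0, 0, 0, 1, 0, 0, 0]) :
    siegelSubgroup (minusForm a 1) ≤ H := by
  obtain ⟨R, hR, hRmem⟩ := exists_rootSubring hH hy hroot
  have h1 := hR 1 R.one_mem
  have haR : a ∈ R := by
    have h3 := (siegelMem_even_mul h2 hH hx h1 h1).swap_vec (s := a)
      (v' := ![0, 0, 0, 0, 1, 0, 0, 0]) (by simp) (by simp [minusForm_apply]) rfl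
    have h4 := (h3.add_self a).swap_vec (s := -a) (v' := ![1, 0, 0, 0, 0, 0, 0, 0])
      (by simp) (by simp [minusForm_apply]) rfl
    exact hRmem _ (Or.inl (h4.congr rfl (by simp)))
  have hRtop : R = ⊤ := by
    rwa [eq_top_iff, ← hclosure, Subring.closure_le, Set.singleton_subset_iff]
  have hr : ∀ s, RootElements a 1 H s := fun s => hR s (hRtop ▸ Subring.mem_top s)
  have hff : ∀ s,
      SiegelMem (minusForm a 1) H ![0, 0, 0, 1, 0, 0, 0, 0] ![0, 0, 0, 0, s, 0, 0, 0] := by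
    intro s
    refine (siegelMem_even_f2f1 h2 hH hx hy ha hr (-s / a ^ 2)).swap_vec (s := -s) ?_
      (by simp [minusForm_apply]) (by simp)
    ext i
    fin_cases i <;> simp [ha]
  have hf2f3 := fun s => (hff s).conj_cycle hH hy
  have hee : ∀ s,
      SiegelMem (minusForm a 1) H ![1, 0, 0, 0, 0, 0, 0, 0] ![0, s, 0, 0, 0, 0, 0, 0] := by
    intro s
    have h3 : SiegelMem (minusForm a 1) H ![0, 1, 0, 0, 0, 1, 0, 0] ![s, 0, 0, 0, 0, 0, 0, 0] := by
      refine (hf2f3 s).conj_invol hH hx ?_ ?_ <;>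
      · ext i
        fin_cases i <;> simp [involEquiv_apply] <;> grind
    refine ((h3.swap_vec (s := s) (v' := ![1, 0, 0, 0, 0, 0, 0, 0]) (by simp)
      (by simp [minusForm_apply]) rfl).sub (hr (-s)).e1f3).congr rfl ?_
    ext i
    fin_cases i <;> simp
    grind
  have hf2 : ∀ r s,
      SiegelMem (minusForm a 1) H ![0, 0, 0, 0, 1, 0, 0, 0] ![0, 0, 0, 0, 0, 0, r, s] := by
    intro r s
    have h3 : SiegelMem (minusForm a 1) H ![0, 0, 0, 0, 1, 0, 0, 0]
        ![0, 0, r, 0, 0, r * a, r, 0] := by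
      refine (siegelMem_even_epsilon h2 hH hx ha hr r).conj_root hH (hee 1) ?_ ?_ <;>
      · ext i
        fin_cases i <;> simp [siegelMap_minusForm, polar_minusForm, minusForm_apply]
    have h4 : SiegelMem (minusForm a 1) H ![0, 0, 0, 0, 1, 0, 0, 0]
        ![0, 0, s * a, 0, 0, s, 0, s] := by
      refine (siegelMem_even_epsilon' h2 hH hx hy ha hr s).conj_root hH (hee 1) ?_ ?_ <;>
      · ext i
        fin_cases i <;> simp [siegelMap_minusForm, polar_minusForm, minusForm_apply]
    refine (((h3.add h4).sub (hr (r + s * a)).f2e3).sub (hf2f3 (r * a + s))).congr rfl ?_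
    ext i
    fin_cases i <;> simp
  refine siegelSubgroup_le_of_rootElements hH hy hr hnd hee hff (fun r s => ?_)
    (fun r s => ((hf2 r s).conj_cycle hH hy).conj_cycle hH hy)
  have h3 : SiegelMem (minusForm a 1) H ![1, 0, 0, 0, 0, 0, 0, 0] ![r, 0, 0, 0, 0, s, r, s] := by
    refine ((hf2 s r).conj_cycle hH hy).conj_invol hH hx ?_ ?_ <;>
    · ext i
      fin_cases i <;> simp [involEquiv_apply] <;> grind
  refine ((h3.sub (hr s).e1f3).add_self (-r)).congr rfl ?_
  ext i
  fin_cases i <;> simp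

end GenerationCharTwo

section Perfect

theorem mem_commutator_of_abelianization {G : Type*} [Group G] {K : Subgroup G} {g : K}
    (h : Abelianization.of g = 1) : (g : G) ∈ ⁅K, K⁆ := by
  rw [← Subgroup.map_subtype_commutator]
  refine ⟨g, ?_, rfl⟩
  rwa [SetLike.mem_coe, ← Abelianization.ker_of K, MonoidHom.mem_ker]

variable {F V : Type*} [Field F] [AddCommGroup V] [Module F V] {Q : QuadraticForm F V}

theorem abelianization_reflEquiv_eq (h2 : (2 : F) ≠ 0) {v v' : V} (hv : Q v ≠ 0) (hv' : Q v' ≠ 0)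
    (hQ : Q v = Q v') (h : polar Q v v' = 0) :
    Abelianization.of (⟨reflEquiv hv, reflEquiv_mem hv⟩ : isometryGroup Q) =
      Abelianization.of ⟨reflEquiv hv', reflEquiv_mem hv'⟩ := by
  have h1 : Q (v - v') = 2 * Q v := by
    rw [sub_eq_add_neg, map_add_polar, QuadraticMap.map_neg, QuadraticMap.polar_neg_right, h, ← hQ]
    ring
  have h3 : Q (v - v') ≠ 0 := by
    rw [h1]
    exact mul_ne_zero h2 hv
  have h4 : reflEquiv h3 v = v' := by
    rw [reflEquiv_apply, QuadraticMap.polar_sub_right, h, QuadraticMap.polar_self, h1, sub_zero,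
      nsmul_eq_mul, Nat.cast_ofNat, div_self (mul_ne_zero h2 hv), one_smul, sub_sub_cancel]
  have h5 : Q (reflEquiv h3 v) ≠ 0 := by rwa [h4]
  have h6 : (⟨reflEquiv h3, reflEquiv_mem h3⟩ : isometryGroup Q) * ⟨reflEquiv hv, reflEquiv_mem hv⟩ *
      ⟨reflEquiv h3, reflEquiv_mem h3⟩⁻¹ = ⟨reflEquiv hv', reflEquiv_mem hv'⟩ := by
    apply Subtype.ext
    refine (conj_reflEquiv hv (reflEquiv_mem h3) h5).trans ?_
    have h7 : ∀ (w : V) (hw : Q w ≠ 0), w = v' → reflEquiv hw = reflEquiv hv' := by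
      rintro w hw rfl
      rfl
    exact h7 _ h5 h4
  rw [← h6, map_mul, map_mul, map_inv, mul_right_comm, mul_inv_cancel, one_mul]

theorem abelianization_reflEquiv_mul_self {v : V} (hv : Q v ≠ 0) :
    Abelianization.of (⟨reflEquiv hv, reflEquiv_mem hv⟩ : isometryGroup Q) *
      Abelianization.of ⟨reflEquiv hv, reflEquiv_mem hv⟩ = 1 := by
  rw [← map_mul, ← map_one Abelianization.of]
  congr 1
  apply Subtype.ext
  ext u
  exact (reflEquiv hv).symm_apply_apply u

/-- The transposition of the first two hyperbolic pairs. -/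
def transposeEquiv (F : Type*) [Field F] : (Fin 8 → F) ≃ₗ[F] (Fin 8 → F) :=
  LinearEquiv.ofInvolutive
    { toFun := fun v => ![v 1, v 0, v 2, v 4, v 3, v 5, v 6, v 7]
      map_add' := fun u v => by ext i; fin_cases i <;> simp
      map_smul' := fun c v => by ext i; fin_cases i <;> simp }
    (fun v => by ext i; fin_cases i <;> simp)

theorem transposeEquiv_apply (v : Fin 8 → F) :
    transposeEquiv F v = ![v 1, v 0, v 2, v 4, v 3, v 5, v 6, v 7] := rfl

theorem transposeEquiv_mem (a m : F) : transposeEquiv F ∈ isometryGroup (minusForm a m) := by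
  intro v
  simp [minusForm_apply, transposeEquiv_apply]
  ring

theorem abelianization_cycleEquiv (a m : F) : Abelianization.of
    (⟨cycleEquiv F, cycleEquiv_mem a m⟩ : isometryGroup (minusForm a m)) = 1 := by
  set s : isometryGroup (minusForm a m) := ⟨transposeEquiv F, transposeEquiv_mem a m⟩
  set y : isometryGroup (minusForm a m) := ⟨cycleEquiv F, cycleEquiv_mem a m⟩
  have h1 : y * s * y = s := by
    apply Subtype.ext
    ext v i
    change cycleEquiv F (transposeEquiv F (cycleEquiv F v)) i = transposeEquiv F v i
    fin_cases i <;> simp [cycleEquiv_apply, transposeEquiv_apply]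
  have h3 : y ^ 3 = 1 := Subtype.ext cycleEquiv_pow_three
  have h4 := congrArg Abelianization.of h1
  have h5 := congrArg Abelianization.of h3
  rw [map_mul, map_mul, mul_right_comm, mul_eq_right] at h4
  rwa [pow_succ, pow_two, map_mul, map_mul, h4, one_mul, map_one] at h5

theorem abelianization_rootEquiv (a m : F) : Abelianization.of
    (⟨rootEquiv a m, siegelEquiv_mem _ _⟩ : isometryGroup (minusForm a m)) = 1 := by
  have he1 : minusForm a m ![1, 0, 0, 0, 0, 0, 0, 0] = 0 := by simp [minusForm_apply]
  have he3 : minusForm a m ![0, 0, 1, 0, 0, 0, 0, 0] = 0 := by simp [minusForm_apply]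
  have hf3 : polar (minusForm a m) ![1, 0, 0, 0, 0, 0, 0, 0] ![0, 0, 0, 0, 0, 1, 0, 0] = 0 := by
    simp [polar_minusForm]
  have hf2 : polar (minusForm a m) ![0, 0, 1, 0, 0, 0, 0, 0] ![0, 0, 0, 0, 1, 0, 0, 0] = 0 := by
    simp [polar_minusForm]
  have h1 : (⟨siegelEquiv he3 hf2, siegelEquiv_mem _ _⟩ : isometryGroup (minusForm a m)) *
      ⟨siegelEquiv he1 hf3, siegelEquiv_mem _ _⟩ = ⟨rootEquiv a m, siegelEquiv_mem _ _⟩ *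
      (⟨siegelEquiv he1 hf3, siegelEquiv_mem _ _⟩ *
      ⟨siegelEquiv he3 hf2, siegelEquiv_mem _ _⟩) := by
    apply Subtype.ext
    ext v i
    change siegelEquiv he3 hf2 (siegelEquiv he1 hf3 v) i =
      rootEquiv a m (siegelEquiv he1 hf3 (siegelEquiv he3 hf2 v)) i
    fin_cases i <;> simp [siegelMap_minusForm, polar_minusForm, minusForm_apply, rootEquiv_apply] <;> ring
  have h3 := congrArg Abelianization.of h1
  rw [map_mul, map_mul, map_mul, mul_comm (Abelianization.of _)] at h3
  exact (mul_eq_right.1 h3.symm)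

theorem reflEquiv_mul_apply {v₁ v₂ v₃ v₄ : V} (h₁ : Q v₁ = 1) (h₂ : Q v₂ = 1) (h₃ : Q v₃ = -1)
    (h₄ : Q v₄ = -1) (h₁₂ : polar Q v₂ v₁ = 0) (h₁₃ : polar Q v₃ v₁ = 0) (h₁₄ : polar Q v₄ v₁ = 0)
    (h₂₃ : polar Q v₃ v₂ = 0) (h₂₄ : polar Q v₄ v₂ = 0) (h₃₄ : polar Q v₄ v₃ = 0) (v : V) :
    (reflEquiv (h₁.trans_ne one_ne_zero) * reflEquiv (h₂.trans_ne one_ne_zero) *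
      reflEquiv (h₃.trans_ne (neg_ne_zero.2 one_ne_zero)) *
      reflEquiv (h₄.trans_ne (neg_ne_zero.2 one_ne_zero))) v =
      v + polar Q v v₄ • v₄ + polar Q v v₃ • v₃ - polar Q v v₂ • v₂ - polar Q v v₁ • v₁ := by
  simp only [LinearEquiv.mul_apply, reflEquiv_apply, h₁, h₂, h₃, h₄, QuadraticMap.polar_sub_left,
    QuadraticMap.polar_add_left, QuadraticMap.polar_smul_left, h₁₂, h₁₃, h₁₄, h₂₃, h₂₄, h₃₄,
    smul_zero, sub_zero, add_zero, div_one, div_neg, neg_smul, sub_neg_eq_add]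

theorem involEquiv_eq_reflEquiv_mul {a : F} (h2 : (2 : F) ≠ 0)
    (h₁ : minusForm a (2 * a + 4) ![0, 1, 0, 0, 1, 0, 0, 0] = 1)
    (h₂ : minusForm a (2 * a + 4)
      ![- a / 2, 0, -1, 1, 0, a / 2, -1 / 2, -1 / 2] = 1)
    (h₃ : minusForm a (2 * a + 4) ![1, 0, 0, 0, 0, 1, 1 / 2, -1 / 2] = -1)
    (h₄ : minusForm a (2 * a + 4)
      ![- a / 2 - 1, 0, -1, 1, 0, a / 2 + 1, -1 / 2, -1 / 2] = -1) :
    involEquiv a (2 * a + 4) 0 (a + 2) =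
      reflEquiv (h₁.trans_ne one_ne_zero) * reflEquiv (h₂.trans_ne one_ne_zero) *
      reflEquiv (h₃.trans_ne (neg_ne_zero.2 one_ne_zero)) *
      reflEquiv (h₄.trans_ne (neg_ne_zero.2 one_ne_zero)) := by
  have h₁₂ : polar (minusForm a (2 * a + 4)) ![- a / 2, 0, -1, 1, 0, a / 2, -1 / 2, -1 / 2]
      ![0, 1, 0, 0, 1, 0, 0, 0] = 0 := by simp [polar_minusForm]
  have h₁₃ : polar (minusForm a (2 * a + 4)) ![1, 0, 0, 0, 0, 1, 1 / 2, -1 / 2]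
      ![0, 1, 0, 0, 1, 0, 0, 0] = 0 := by simp [polar_minusForm]
  have h₁₄ : polar (minusForm a (2 * a + 4))
      ![- a / 2 - 1, 0, -1, 1, 0, a / 2 + 1, -1 / 2, -1 / 2] ![0, 1, 0, 0, 1, 0, 0, 0] = 0 := by
    simp [polar_minusForm]
  have h₂₃ : polar (minusForm a (2 * a + 4)) ![1, 0, 0, 0, 0, 1, 1 / 2, -1 / 2]
      ![- a / 2, 0, -1, 1, 0, a / 2, -1 / 2, -1 / 2] = 0 := by
    simp [polar_minusForm]
    field_simp
    ring
  have h₂₄ : polar (minusForm a (2 * a + 4))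
      ![- a / 2 - 1, 0, -1, 1, 0, a / 2 + 1, -1 / 2, -1 / 2]
      ![- a / 2, 0, -1, 1, 0, a / 2, -1 / 2, -1 / 2] = 0 := by
    simp [polar_minusForm]
    field_simp
    ring
  have h₃₄ : polar (minusForm a (2 * a + 4))
      ![- a / 2 - 1, 0, -1, 1, 0, a / 2 + 1, -1 / 2, -1 / 2]
      ![1, 0, 0, 0, 0, 1, 1 / 2, -1 / 2] = 0 := by
    simp [polar_minusForm]
    field_simp
    ring
  ext v i
  rw [reflEquiv_mul_apply h₁ h₂ h₃ h₄ h₁₂ h₁₃ h₁₄ h₂₃ h₂₄ h₃₄, involEquiv_apply]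
  simp only [polar_minusForm, Pi.add_apply, Pi.sub_apply, Pi.smul_apply, smul_eq_mul]
  fin_cases i <;> simp <;> field_simp <;> ring

theorem abelianization_involEquiv_odd {a : F} (h2 : (2 : F) ≠ 0) : Abelianization.of
    (⟨involEquiv a (2 * a + 4) 0 (a + 2), involEquiv_mem _ _ _ _⟩ :
      isometryGroup (minusForm a (2 * a + 4))) = 1 := by
  have h₁ : minusForm a (2 * a + 4) ![0, 1, 0, 0, 1, 0, 0, 0] = 1 := by simp [minusForm_apply]
  have h₂ : minusForm a (2 * a + 4) ![- a / 2, 0, -1, 1, 0, a / 2, -1 / 2, -1 / 2] = 1 := by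
    simp [minusForm_apply]
    field_simp
    ring
  have h₃ : minusForm a (2 * a + 4) ![1, 0, 0, 0, 0, 1, 1 / 2, -1 / 2] = -1 := by
    simp [minusForm_apply]
    field_simp
    ring
  have h₄ : minusForm a (2 * a + 4)
      ![- a / 2 - 1, 0, -1, 1, 0, a / 2 + 1, -1 / 2, -1 / 2] = -1 := by
    simp [minusForm_apply]
    field_simp
    ring
  have h₅ := abelianization_reflEquiv_eq h2 (h₁.trans_ne one_ne_zero) (h₂.trans_ne one_ne_zero)
    (h₁.trans h₂.symm) (by simp [polar_minusForm])
  have h₆ := abelianization_reflEquiv_eq h2 (h₃.trans_ne (neg_ne_zero.2 one_ne_zero))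
    (h₄.trans_ne (neg_ne_zero.2 one_ne_zero)) (h₃.trans h₄.symm) (by
      simp [polar_minusForm]
      field_simp
      ring)
  rw [show (⟨involEquiv a (2 * a + 4) 0 (a + 2), involEquiv_mem _ _ _ _⟩ :
      isometryGroup (minusForm a (2 * a + 4))) =
      ⟨_, reflEquiv_mem (h₁.trans_ne one_ne_zero)⟩ * ⟨_, reflEquiv_mem (h₂.trans_ne one_ne_zero)⟩ *
      ⟨_, reflEquiv_mem (h₃.trans_ne (neg_ne_zero.2 one_ne_zero))⟩ *
      ⟨_, reflEquiv_mem (h₄.trans_ne (neg_ne_zero.2 one_ne_zero))⟩ from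
        Subtype.ext (involEquiv_eq_reflEquiv_mul h2 h₁ h₂ h₃ h₄), map_mul, map_mul, map_mul,
    ← h₅, ← h₆, abelianization_reflEquiv_mul_self, one_mul, abelianization_reflEquiv_mul_self]

theorem abelianization_involEquiv_even (h2 : (2 : F) = 0) {a m c t : F} {N : ℕ}
    (hN : (N : F) ≠ 0) (h : (involEquiv a m c t * cycleEquiv F) ^ N * rootEquiv a m ^ N = 1) :
    Abelianization.of (⟨involEquiv a m c t, involEquiv_mem _ _ _ _⟩ :
      isometryGroup (minusForm a m)) = 1 := by
  have h1 : ((⟨involEquiv a m c t, involEquiv_mem _ _ _ _⟩ : isometryGroup (minusForm a m)) *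
      ⟨cycleEquiv F, cycleEquiv_mem a m⟩) ^ N * ⟨rootEquiv a m, siegelEquiv_mem _ _⟩ ^ N = 1 :=
    Subtype.ext h
  have h3 : (⟨involEquiv a m c t, involEquiv_mem _ _ _ _⟩ : isometryGroup (minusForm a m)) ^ 2 =
      1 := Subtype.ext (involEquiv_pow_two a m c t)
  have h4 := congrArg Abelianization.of h1
  rw [map_mul, map_pow, map_pow, map_mul, abelianization_cycleEquiv, abelianization_rootEquiv,
    one_pow, mul_one, mul_one, map_one] at h4
  have h5 := congrArg Abelianization.of h3
  rw [map_pow, map_one] at h5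
  obtain ⟨k, hk | hk⟩ := Nat.even_or_odd' N
  · rw [hk, Nat.cast_mul, Nat.cast_ofNat, h2, zero_mul] at hN
    exact absurd rfl hN
  · rwa [hk, pow_succ, pow_mul, h5, one_pow, one_mul] at h4

/-- The two generators generate the derived subgroup of the isometry group as soon as they lie in
it and generate all Siegel transformations. -/
theorem closure_eq_commutator {a m c t : F}
    (hE : ∀ s t : F, a * (s * s) + m * (s * t) + a * (t * t) = 0 → s = 0 ∧ t = 0)
    (hnd : ∀ u : Fin 8 → F, (∀ v, polar (minusForm a m) u v = 0) → u = 0)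
    (hx : Abelianization.of (⟨involEquiv a m c t, involEquiv_mem _ _ _ _⟩ :
      isometryGroup (minusForm a m)) = 1)
    (h : siegelSubgroup (minusForm a m) ≤
      Subgroup.closure {involEquiv a m c t, cycleEquiv F}) :
    Subgroup.closure {involEquiv a m c t, cycleEquiv F} =
      ⁅isometryGroup (minusForm a m), isometryGroup (minusForm a m)⁆ := by
  refine le_antisymm ((Subgroup.closure_le _).2 ?_) (((twoHyperbolicPairs_minusForm a m).commutator_le
    hnd (isometryGroup_minusForm_le hE)).trans h)
  rintro g (rfl | rfl)
  · exact mem_commutator_of_abelianization hx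
  · exact mem_commutator_of_abelianization (abelianization_cycleEquiv a m)

theorem closure_le_isometryGroup (a m c t : F) :
    Subgroup.closure {involEquiv a m c t, cycleEquiv F} ≤ isometryGroup (minusForm a m) := by
  refine (Subgroup.closure_le _).2 ?_
  rintro g (rfl | rfl)
  exacts [involEquiv_mem _ _ _ _, cycleEquiv_mem _ _]

theorem closure_eq_commutator_odd [Finite F] {a : F} (h2 : (2 : F) ≠ 0) (ha : a ≠ 0)
    (ha8 : a - 8 ≠ 0) (ha1 : a + 1 ≠ 0)
    (hclosure : Subring.closure {a + 1} = (⊤ : Subring F))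
    (hE : ∀ s t : F, a * (s * s) + (2 * a + 4) * (s * t) + a * (t * t) = 0 → s = 0 ∧ t = 0) :
    Subgroup.closure {involEquiv a (2 * a + 4) 0 (a + 2), cycleEquiv F} =
      ⁅isometryGroup (minusForm a (2 * a + 4)), isometryGroup (minusForm a (2 * a + 4))⁆ := by
  have hnd := minusForm_nondegenerate (a := a) (m := 2 * a + 4) (by
    rw [show 2 * a * (2 * a) - (2 * a + 4) * (2 * a + 4) = -(2 * 2 * 2 * 2 * (a + 1)) by ring]
    exact neg_ne_zero.2 (by simp [h2, ha1]))
  have hx := Subgroup.subset_closure (Set.mem_insert (involEquiv a (2 * a + 4) 0 (a + 2))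
    {cycleEquiv F})
  have hy := Subgroup.subset_closure (Set.mem_insert_of_mem (involEquiv a (2 * a + 4) 0 (a + 2))
    (Set.mem_singleton (cycleEquiv F)))
  obtain ⟨N, hN, h⟩ := exists_pow_mul_rootEquiv_pow (a := a) (m := 2 * a + 4) (c := 0)
    (t := a + 2) (by ring) (by ring) (squarefree_annihilator_odd h2 ha ha8 ha1)
  exact closure_eq_commutator hE hnd (abelianization_involEquiv_odd h2)
    (siegelSubgroup_le_odd (closure_le_isometryGroup _ _ _ _) hx hy ha hclosure hnd
      (siegelMem_of_pow (mul_mem hx hy) hN h))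

theorem closure_eq_commutator_even [Finite F] {a : F} (h2 : (2 : F) = 0) (ha : a ≠ 0)
    (hclosure : Subring.closure {a} = (⊤ : Subring F))
    (hE : ∀ s t : F, a * (s * s) + 1 * (s * t) + a * (t * t) = 0 → s = 0 ∧ t = 0) :
    Subgroup.closure {involEquiv a 1 1 (a + 1), cycleEquiv F} =
      ⁅isometryGroup (minusForm a 1), isometryGroup (minusForm a 1)⁆ := by
  have hnd := minusForm_nondegenerate (a := a) (m := 1) (by simp [h2])
  have hx := Subgroup.subset_closure (Set.mem_insert (involEquiv a 1 1 (a + 1)) {cycleEquiv F})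
  have hy := Subgroup.subset_closure (Set.mem_insert_of_mem (involEquiv a 1 1 (a + 1))
    (Set.mem_singleton (cycleEquiv F)))
  obtain ⟨N, hN, h⟩ := exists_pow_mul_rootEquiv_pow (a := a) (m := 1) (c := 1) (t := a + 1)
    (by grind) (by grind) (squarefree_annihilator_even h2 ha)
  exact closure_eq_commutator hE hnd (abelianization_involEquiv_even h2 hN h)
    (siegelSubgroup_le_even h2 (closure_le_isometryGroup _ _ _ _) hx hy ha hclosure hnd
      (siegelMem_of_pow (mul_mem hx hy) hN h))

end Perfect

section FiniteField

variable {F : Type*} [Field F] [Finite F]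

theorem exists_not_isSquare_closure_eq_top (h2 : (2 : F) ≠ 0) :
    ∃ d : F, ¬IsSquare d ∧ Subring.closure {d} = (⊤ : Subring F) := by
  obtain ⟨g, hg⟩ := IsCyclic.exists_generator (α := Fˣ)
  have hpow : ∀ x : F, x ≠ 0 → ∃ n : ℕ, (g : F) ^ n = x := fun x hx => by
    obtain ⟨n, hn⟩ := mem_powers_iff_mem_zpowers.2 (hg (Units.mk0 x hx))
    refine ⟨n, ?_⟩
    rw [← Units.val_pow_eq_pow_val]
    exact congrArg Units.val hn
  refine ⟨g, fun hsq => ?_, eq_top_iff.2 fun x _ => ?_⟩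
  · obtain ⟨x, hx⟩ := FiniteField.exists_nonsquare (F := F) fun h => h2 (by
      have := ringChar.Nat.cast_ringChar (R := F)
      rwa [h, Nat.cast_ofNat] at this)
    obtain ⟨n, rfl⟩ := hpow x fun h => hx (h ▸ IsSquare.zero)
    exact hx (hsq.pow n)
  · obtain rfl | hx := eq_or_ne x 0
    · exact zero_mem _
    · obtain ⟨n, rfl⟩ := hpow x hx
      exact pow_mem (Subring.subset_closure (Set.mem_singleton _)) n

theorem isSquare_mul_of_not_isSquare {x y : F} (hx : ¬IsSquare x) (hy : ¬IsSquare y) :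
    IsSquare (x * y) := by
  classical
  have := Fintype.ofFinite F
  have hx0 : x ≠ 0 := fun h => hx (h ▸ IsSquare.zero)
  have hy0 : y ≠ 0 := fun h => hy (h ▸ IsSquare.zero)
  rw [← quadraticChar_one_iff_isSquare (mul_ne_zero hx0 hy0), map_mul, quadraticChar_neg_one_iff_not_isSquare.2 hx,
    quadraticChar_neg_one_iff_not_isSquare.2 hy, neg_mul_neg, one_mul]


theorem exists_artinSchreier_closure_eq_top (h2 : (2 : F) = 0) :
    ∃ a : F, (∀ z : F, a ≠ z * z + z) ∧ Subring.closure {a} = (⊤ : Subring F) := by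
  have : CharP F 2 := CharTwo.of_one_ne_zero_of_two_eq_zero one_ne_zero h2
  have : Algebra (ZMod 2) F := ZMod.algebra F 2
  have := Fintype.ofFinite (Gal(F/ZMod 2))
  obtain ⟨a, ha⟩ := exists_linearIndependent_algEquiv_apply (ZMod 2) F
  refine ⟨a, fun z hz => ?_, ?_⟩
  · have h : ∑ σ : Gal(F/ZMod 2), (1 : ZMod 2) • σ a = 0 := by
      simp only [one_smul, hz, map_add, Finset.sum_add_distrib]
      rw [← Equiv.sum_comp (Equiv.mulRight (FiniteField.frobeniusAlgEquivOfAlgebraic (ZMod 2) F))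
        fun σ => σ z]
      simp [← two_mul, h2, pow_two]
    exact one_ne_zero (Fintype.linearIndependent_iff.1 ha (fun _ => 1) h 1)
  · have h : IntermediateField.adjoin (ZMod 2) {a} = ⊤ := by
      rw [← IsGalois.fixedField_fixingSubgroup (IntermediateField.adjoin (ZMod 2) {a}),
        ← IsGalois.fixedField_fixingSubgroup (⊤ : IntermediateField (ZMod 2) F)]
      congr 1
      rw [IntermediateField.fixingSubgroup_top, eq_bot_iff]
      intro σ hσ
      rw [IntermediateField.mem_fixingSubgroup_iff] at hσ
      exact ha.injective (hσ a (IntermediateField.mem_adjoin_simple_self _ a))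
    refine eq_top_iff.2 fun x _ => ?_
    have hx : x ∈ (IntermediateField.adjoin (ZMod 2) {a}).toSubalgebra := by
      rw [h]
      trivial
    rw [IntermediateField.adjoin_simple_toSubalgebra_of_isAlgebraic
      (Algebra.IsAlgebraic.isAlgebraic a)] at hx
    induction hx using Algebra.adjoin_induction with
    | mem x hx => exact Subring.subset_closure hx
    | algebraMap r =>
      obtain ⟨n, rfl⟩ := ZMod.natCast_zmod_surjective r
      rw [map_natCast]
      exact natCast_mem _ n
    | add x y _ _ hx hy => exact add_mem (hx trivial) (hy trivial)
    | mul x y _ _ hx hy => exact mul_mem (hx trivial) (hy trivial)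

theorem exists_add_eq_artinSchreier (h2 : (2 : F) = 0) {x y : F} (hx : ∀ z : F, x ≠ z * z + z)
    (hy : ∀ z : F, y ≠ z * z + z) : ∃ z : F, x + y = z * z + z := by
  let f : F →+ F :=
    { toFun := fun z => z * z + z
      map_zero' := by ring
      map_add' := fun z w => by linear_combination z * w * h2 }
  have hker : Nat.card f.ker = 2 := by
    have : (f.ker : Set F) = {0, 1} := by
      ext z
      change z * z + z = 0 ↔ z = 0 ∨ z = 1
      rw [show z * z + z = z * (z - 1) by linear_combination z * h2, mul_eq_zero, sub_eq_zero]
    rw [← SetLike.coe_sort_coe, this, Nat.card_coe_set_eq, Set.ncard_pair zero_ne_one]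
  have hindex : f.range.index = 2 := by
    have h := f.range.card_mul_index.trans f.ker.card_mul_index.symm
    rw [AddSubgroup.index_ker, hker, mul_comm 2] at h
    exact Nat.eq_of_mul_eq_mul_left Nat.card_pos h
  obtain ⟨z, hz⟩ := (AddSubgroup.add_mem_iff_of_index_two hindex).2
    (iff_of_false (fun ⟨z, hz⟩ => hx z hz.symm) (fun ⟨z, hz⟩ => hy z hz.symm))
  exact ⟨z, hz.symm⟩

/-- A binary form whose discriminant is a nonsquare represents, up to a scalar, any other such
form. -/
theorem exists_binary_odd (h2 : (2 : F) ≠ 0) {a p r k : F} (ha : ¬IsSquare (a + 1))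
    (h : ∀ s t : F, p * (s * s) + r * (s * t) + k * (t * t) = 0 → s = 0 ∧ t = 0) :
    ∃ b x y x' y' : F, b ≠ 0 ∧ b * (p * (x * x) + r * (x * y) + k * (y * y)) = a ∧
      b * (p * (x' * x') + r * (x' * y') + k * (y' * y')) = a ∧
      b * (2 * p * (x * x') + r * (x * y' + x' * y) + 2 * k * (y * y')) = 2 * a + 4 := by
  have hp : p ≠ 0 := by
    rintro rfl
    exact one_ne_zero (h 1 0 (by ring)).1
  have hd : ¬IsSquare ((r * r - 4 * p * k)) := by
    rintro ⟨z, hz⟩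
    have := (h (z - r) (2 * p) (by linear_combination -p * hz)).2
    exact mul_ne_zero h2 hp this
  obtain ⟨z, hz⟩ := isSquare_mul_of_not_isSquare ha hd
  have hz0 : z ≠ 0 := by
    rintro rfl
    rw [zero_mul, mul_eq_zero] at hz
    rcases hz with hz | hz
    · exact ha (hz ▸ IsSquare.zero)
    · exact hd (hz ▸ IsSquare.zero)
  have ha0 : a + 1 ≠ 0 := fun h => ha (h ▸ IsSquare.zero)
  refine ⟨-p⁻¹, 1 - r * ((a + 1) / z), 2 * p * ((a + 1) / z), -1 - r * ((a + 1) / z),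
    2 * p * ((a + 1) / z), neg_ne_zero.2 (inv_ne_zero hp), ?_, ?_, ?_⟩
  all_goals
    field_simp
    first
    | linear_combination (a + 1) * hz
    | linear_combination 2 * (a + 1) * hz

theorem exists_binary_even (h2 : (2 : F) = 0) {a p r k : F} (ha : ∀ z : F, a ≠ z * z + z)
    (h : ∀ s t : F, p * (s * s) + r * (s * t) + k * (t * t) = 0 → s = 0 ∧ t = 0) :
    ∃ b x y x' y' : F, b ≠ 0 ∧ b * (p * (x * x) + r * (x * y) + k * (y * y)) = a ∧
      b * (p * (x' * x') + r * (x' * y') + k * (y' * y')) = a ∧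
      b * (2 * p * (x * x') + r * (x * y' + x' * y) + 2 * k * (y * y')) = 1 := by
  have : CharP F 2 := CharTwo.of_one_ne_zero_of_two_eq_zero one_ne_zero h2
  have hp : p ≠ 0 := by
    rintro rfl
    exact one_ne_zero (h 1 0 (by ring)).1
  have hr : r ≠ 0 := by
    rintro rfl
    obtain ⟨z, hz⟩ := FiniteField.isSquare_of_char_two (ringChar.eq F 2) (k / p)
    rw [div_eq_iff hp] at hz
    exact one_ne_zero (h z 1 (by linear_combination -hz + k * h2)).2
  have ha0 : a ≠ 0 := fun h => ha 0 (by rw [h]; ring)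
  obtain ⟨z, hz⟩ := exists_add_eq_artinSchreier h2 (x := p * k / (r * r)) (y := a * a)
    (fun z hz => hp (h (r * z) p (by
      field_simp at hz
      linear_combination p * hz + (p * r ^ 2 * z ^ 2 + p * r ^ 2 * z) * h2)).2)
    (fun z hz => ha (z + a) (by linear_combination hz - (a * a + z * a) * h2))
  field_simp at hz
  refine ⟨a / p, 1, 0, z / a, p / (r * a), div_ne_zero ha0 hp, ?_, ?_, ?_⟩
  · field_simp
    ring
  · field_simp
    linear_combination hz + (r ^ 2 * z ^ 2 + r ^ 2 * z - r ^ 2 * a ^ 2) * h2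
  · field_simp
    linear_combination r * p * z * h2

end FiniteField

section Transport

theorem IsTwoThreeGenerated.of_injective {G H : Type*} [Group G] [Group H] {f : H →* G}
    (hf : Function.Injective f) {x y : G} (hx : orderOf x = 2) (hy : orderOf y = 3)
    (h : Subgroup.closure {x, y} = f.range) : IsTwoThreeGenerated H := by
  obtain ⟨x, rfl⟩ : x ∈ f.range := h ▸ Subgroup.subset_closure (Set.mem_insert _ _)
  obtain ⟨y, rfl⟩ : y ∈ f.range :=
    h ▸ Subgroup.subset_closure (Set.mem_insert_of_mem _ (Set.mem_singleton _))
  refine ⟨x, y, by rwa [orderOf_injective f hf] at hx, by rwa [orderOf_injective f hf] at hy,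
    Subgroup.map_injective hf ?_⟩
  rw [MonoidHom.map_closure, Set.image_pair, h, MonoidHom.range_eq_map]

theorem IsTwoThreeGenerated.commutator_of_map {G G' : Type*} [Group G] [Group G'] (f : G ≃* G')
    {K : Subgroup G} {K' : Subgroup G'} (hK : ∀ g, g ∈ K ↔ f g ∈ K') {x y : G'}
    (hx : orderOf x = 2) (hy : orderOf y = 3) (h : Subgroup.closure {x, y} = ⁅K', K'⁆) :
    IsTwoThreeGenerated (commutator K) := by
  have hmap : K.map f.toMonoidHom = K' := by
    rw [← (Subgroup.ext fun g => (hK g).symm : K'.comap f.toMonoidHom = K),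
      Subgroup.map_comap_eq_self_of_surjective f.surjective]
  refine IsTwoThreeGenerated.of_injective
    (f := f.toMonoidHom.comp (K.subtype.comp (commutator K).subtype))
    (f.injective.comp (Subtype.val_injective.comp Subtype.val_injective)) hx hy ?_
  rw [h, MonoidHom.range_comp, MonoidHom.range_comp, Subgroup.range_subtype,
    Subgroup.map_subtype_commutator, Subgroup.map_commutator, hmap]

variable {F : Type*} [Field F]

/-- If a scalar multiple of `Q` is equivalent to `Q'`, it suffices to generate the derived
subgroup of the isometry group of `Q'`. -/
theorem isTwoThreeGenerated_of_similar {Q Q' : QuadraticForm F (Fin 8 → F)}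
    (L : (Fin 8 → F) ≃ₗ[F] (Fin 8 → F)) {b : F} (hb : b ≠ 0) (hL : ∀ v, b * Q (L v) = Q' v)
    {x y : (Fin 8 → F) ≃ₗ[F] (Fin 8 → F)} (hx : orderOf x = 2) (hy : orderOf y = 3)
    (h : Subgroup.closure {x, y} = ⁅isometryGroup Q', isometryGroup Q'⁆) :
    IsTwoThreeGenerated (commutator (orthogonalGroupOf F Q)) := by
  have hQ : ∀ v w, Q v = Q w ↔ Q' (L⁻¹ v) = Q' (L⁻¹ w) := fun v w => by
    rw [← hL, ← hL, mul_right_inj' hb, ← LinearEquiv.mul_apply, ← LinearEquiv.mul_apply,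
      mul_inv_cancel]
    rfl
  refine IsTwoThreeGenerated.commutator_of_map
    ((Matrix.GeneralLinearGroup.toLin.trans
      (LinearMap.GeneralLinearGroup.generalLinearEquiv F (Fin 8 → F))).trans (MulAut.conj L⁻¹))
    (fun g => ?_) hx hy h
  rw [mem_isometryGroup, L.symm.surjective.forall]
  refine forall_congr' fun v => (hQ _ _).trans ?_
  rw [MulEquiv.trans_apply, MulEquiv.trans_apply, MulAut.conj_apply, inv_inv,
    LinearEquiv.mul_apply, LinearEquiv.mul_apply, LinearEquiv.apply_symm_apply]
  rfl

/-- A totally singular space of dimension three is half of a sum of three hyperbolic planes. -/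
theorem exists_hyperbolic_triple {V : Type*} [AddCommGroup V] [Module F V] [FiniteDimensional F V]
    {Q : QuadraticForm F V} (hnd : ∀ u, (∀ v, polar Q u v = 0) → u = 0) {W : Submodule F V}
    (hW : Module.finrank F W = 3) (hQ : ∀ w ∈ W, Q w = 0) :
    ∃ e f : Fin 3 → V, (∀ i, e i ∈ W) ∧ (∀ i, Q (f i) = 0) ∧
      (∀ i j, polar Q (e i) (e j) = 0) ∧ (∀ i j, i ≠ j → polar Q (f i) (f j) = 0) ∧
      ∀ i j, polar Q (e i) (f j) = if i = j then 1 else 0 := by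
  have hWW : ∀ u ∈ W, ∀ v ∈ W, polar Q u v = 0 := fun u hu v hv => by
    rw [polar, hQ _ (add_mem hu hv), hQ _ hu, hQ _ hv, sub_zero, sub_zero]
  let B := Module.finBasisOfFinrankEq F W hW
  have hsurj : Function.Surjective Q.polarBilin :=
    (LinearMap.injective_iff_surjective_of_finrank_eq_finrank
      (Subspace.dual_finrank_eq (K := F) (V := V)).symm).1
      ((injective_iff_map_eq_zero _).2 fun u hu => hnd u fun v => LinearMap.congr_fun hu v)
  have hdual : ∀ j, ∃ f : V, ∀ i, polar Q (B i : V) f = if i = j then 1 else 0 := fun j => by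
    obtain ⟨φ, hφ⟩ := Subspace.dualRestrict_surjective (B.coord j)
    obtain ⟨f, rfl⟩ := hsurj φ
    refine ⟨f, fun i => ?_⟩
    have h := LinearMap.congr_fun hφ (B i)
    rw [QuadraticMap.polar_comm]
    refine h.trans ?_
    rw [Module.Basis.coord_apply, Module.Basis.repr_self, Finsupp.single_apply]
  choose g hg using hdual
  have hg' : ∀ i j, polar Q (g j) (B i : V) = if i = j then 1 else 0 := fun i j => by
    rw [QuadraticMap.polar_comm, hg]
  have hBB : ∀ i j, polar Q (B i : V) (B j : V) = 0 := fun i j => hWW _ (B i).2 _ (B j).2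
  have hB : ∀ i, Q (B i : V) = 0 := fun i => hQ _ (B i).2
  refine ⟨fun i => B i, ![g 0 - Q (g 0) • (B 0 : V),
    g 1 - Q (g 1) • (B 1 : V) - polar Q (g 1) (g 0) • (B 0 : V),
    g 2 - Q (g 2) • (B 2 : V) - polar Q (g 2) (g 0) • (B 0 : V) -
      polar Q (g 2) (g 1) • (B 1 : V)], fun i => (B i).2, ?_, hBB, ?_, ?_⟩
  · intro i
    fin_cases i <;> simp [sub_eq_add_neg, ← neg_smul, map_add_polar, QuadraticMap.map_smul,
      QuadraticMap.polar_add_left, QuadraticMap.polar_smul_left, QuadraticMap.polar_smul_right,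
      hg', hBB, hB]
  · have h01 := QuadraticMap.polar_comm Q (g 0) (g 1)
    have h02 := QuadraticMap.polar_comm Q (g 0) (g 2)
    have h12 := QuadraticMap.polar_comm Q (g 1) (g 2)
    intro i j hij
    fin_cases i <;> fin_cases j <;> simp [QuadraticMap.polar_sub_left,
      QuadraticMap.polar_sub_right, QuadraticMap.polar_smul_left, QuadraticMap.polar_smul_right,
      hg, hg', hBB, h01, h02, h12] at hij ⊢
  · intro i j
    fin_cases i <;> fin_cases j <;> simp [QuadraticMap.polar_sub_right,
      QuadraticMap.polar_smul_right, hg, hBB]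

/-- The Witt decomposition of a form of minus type in dimension eight. -/
theorem exists_witt_decomposition {Q : QuadraticForm F (Fin 8 → F)}
    (hnd : ∀ u, (∀ v, polar Q u v = 0) → u = 0)
    (h3 : ∃ W : Submodule F (Fin 8 → F), Module.finrank F W = 3 ∧ ∀ w ∈ W, Q w = 0)
    (h4 : ¬ ∃ W : Submodule F (Fin 8 → F), Module.finrank F W = 4 ∧ ∀ w ∈ W, Q w = 0) :
    ∃ (e f : Fin 3 → Fin 8 → F) (u v : Fin 8 → F), (∀ i, Q (e i) = 0) ∧ (∀ i, Q (f i) = 0) ∧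
      (∀ i j, polar Q (e i) (e j) = 0) ∧ (∀ i j, i ≠ j → polar Q (f i) (f j) = 0) ∧
      (∀ i j, polar Q (e i) (f j) = if i = j then 1 else 0) ∧
      (∀ i, polar Q (e i) u = 0 ∧ polar Q (e i) v = 0 ∧ polar Q (f i) u = 0 ∧
        polar Q (f i) v = 0) ∧
      ∀ s t : F, Q u * (s * s) + polar Q u v * (s * t) + Q v * (t * t) = 0 → s = 0 ∧ t = 0 := by
  obtain ⟨W, hW, hQ⟩ := h3
  obtain ⟨e, f, he, hf, hee, hff, hef⟩ := exists_hyperbolic_triple hnd hW hQ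
  let φ : (Fin 8 → F) →ₗ[F] (Fin 3 → F) × (Fin 3 → F) :=
    (LinearMap.pi fun i => Q.polarBilin (e i)).prod (LinearMap.pi fun i => Q.polarBilin (f i))
  have hker : ∀ w ∈ LinearMap.ker φ, ∀ i, polar Q (e i) w = 0 ∧ polar Q (f i) w = 0 :=
    fun w hw i => ⟨congrFun (congrArg Prod.fst hw) i, congrFun (congrArg Prod.snd hw) i⟩
  have haniso : ∀ w ∈ LinearMap.ker φ, Q w = 0 → w = 0 := by
    intro w hw hw0
    by_contra hne
    have hli : LinearIndependent F ![e 0, e 1, e 2, w] := by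
      refine Fintype.linearIndependent_iff.2 fun c hc => ?_
      simp only [Fin.sum_univ_four, Matrix.cons_val] at hc
      have hpair : ∀ j, polar Q (c 0 • e 0 + c 1 • e 1 + c 2 • e 2 + c 3 • w) (f j) = 0 :=
        fun j => by rw [hc, QuadraticMap.polar_zero_left]
      simp only [QuadraticMap.polar_add_left, QuadraticMap.polar_smul_left, hef,
        QuadraticMap.polar_comm Q w, (hker w hw _).2] at hpair
      have hc0 : c 0 = 0 := by simpa using hpair 0
      have hc1 : c 1 = 0 := by simpa using hpair 1
      have hc2 : c 2 = 0 := by simpa using hpair 2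
      have hc3 : c 3 = 0 := by simpa [hc0, hc1, hc2, hne] using hc
      intro i
      fin_cases i <;> assumption
    refine h4 ⟨Submodule.span F (Set.range ![e 0, e 1, e 2, w]),
      (finrank_span_eq_card hli).trans (Fintype.card_fin 4), fun x hx => ?_⟩
    obtain ⟨c, rfl⟩ := (Submodule.mem_span_range_iff_exists_fun F).1 hx
    simp [Fin.sum_univ_four, map_add_polar, QuadraticMap.map_smul, QuadraticMap.polar_add_left,
      QuadraticMap.polar_smul_left, QuadraticMap.polar_smul_right, hee, (hker w hw _).1, hw0,
      hQ _ (he _)]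
  have hrank : 1 < Module.finrank F (LinearMap.ker φ) := by
    have h := φ.finrank_range_add_finrank_ker
    have h' := Submodule.finrank_le (LinearMap.range φ)
    rw [Module.finrank_prod, Module.finrank_fin_fun] at h'
    rw [Module.finrank_fin_fun] at h
    omega
  have : Nontrivial (LinearMap.ker φ) := Module.nontrivial_of_finrank_pos (zero_lt_one.trans hrank)
  obtain ⟨u, hu⟩ := exists_ne (0 : LinearMap.ker φ)
  obtain ⟨v, huv⟩ := exists_linearIndependent_pair_of_one_lt_finrank hrank hu
  refine ⟨e, f, u, v, fun i => hQ _ (he i), hf, hee, hff, hef, fun i => ⟨(hker u u.2 i).1,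
    (hker v v.2 i).1, (hker u u.2 i).2, (hker v v.2 i).2⟩, fun s t hst => ?_⟩
  refine LinearIndependent.pair_iff.1 huv s t (Subtype.ext (haniso _ (s • u + t • v).2 ?_))
  rw [← hst]
  simp only [Submodule.coe_add, Submodule.coe_smul, map_add_polar, QuadraticMap.map_smul,
    QuadraticMap.polar_smul_left, QuadraticMap.polar_smul_right, smul_eq_mul]
  ring

/-- A form of minus type in dimension eight is similar to a standard form. -/
theorem exists_similar_minusForm {Q : QuadraticForm F (Fin 8 → F)}
    (hnd : ∀ u, (∀ v, polar Q u v = 0) → u = 0)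
    (h3 : ∃ W : Submodule F (Fin 8 → F), Module.finrank F W = 3 ∧ ∀ w ∈ W, Q w = 0)
    (h4 : ¬ ∃ W : Submodule F (Fin 8 → F), Module.finrank F W = 4 ∧ ∀ w ∈ W, Q w = 0) {a m : F}
    (ham : 2 * a * (2 * a) - m * m ≠ 0)
    (hbin : ∀ p r k : F,
      (∀ s t : F, p * (s * s) + r * (s * t) + k * (t * t) = 0 → s = 0 ∧ t = 0) →
      ∃ b x y x' y' : F, b ≠ 0 ∧ b * (p * (x * x) + r * (x * y) + k * (y * y)) = a ∧
        b * (p * (x' * x') + r * (x' * y') + k * (y' * y')) = a ∧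
        b * (2 * p * (x * x') + r * (x * y' + x' * y) + 2 * k * (y * y')) = m) :
    ∃ (L : (Fin 8 → F) ≃ₗ[F] (Fin 8 → F)) (b : F), b ≠ 0 ∧ ∀ v, b * Q (L v) = minusForm a m v := by
  obtain ⟨e, f, u, v, he, hf, hee, hff, hef, huv, haniso⟩ := exists_witt_decomposition hnd h3 h4
  obtain ⟨b, x, y, x', y', hb, h₁, h₂, h₃⟩ := hbin _ _ _ haniso
  let L : (Fin 8 → F) →ₗ[F] (Fin 8 → F) := Fintype.linearCombination F
    ![e 0, e 1, e 2, b⁻¹ • f 0, b⁻¹ • f 1, b⁻¹ • f 2, x • u + y • v, x' • u + y' • v]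
  have hL : ∀ w, b * Q (L w) = minusForm a m w := fun w => by
    have h01 := hff 0 1 (by decide)
    have h02 := hff 0 2 (by decide)
    have h12 := hff 1 2 (by decide)
    have hvu := QuadraticMap.polar_comm Q v u
    simp only [L, Fintype.linearCombination_apply, Fin.sum_univ_eight, Matrix.cons_val,
      map_add_polar, QuadraticMap.map_smul, QuadraticMap.polar_add_left,
      QuadraticMap.polar_add_right, QuadraticMap.polar_smul_left, QuadraticMap.polar_smul_right,
      he, hf, hee, h01, h02, h12, hef, huv, QuadraticMap.polar_self, hvu, minusForm_apply]
    simp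
    linear_combination w 6 * w 6 * h₁ + w 7 * w 7 * h₂ + w 6 * w 7 * h₃ +
      (w 0 * w 3 + w 1 * w 4 + w 2 * w 5) * mul_inv_cancel₀ hb
  have hinj : Function.Injective L := (injective_iff_map_eq_zero L).2 fun w hw =>
    minusForm_nondegenerate ham w fun z => by
      rw [polar, ← hL, ← hL, ← hL, map_add, hw, zero_add, QuadraticMap.map_zero, mul_zero,
        sub_zero, sub_self]
  exact ⟨LinearEquiv.ofInjectiveEndo L hinj, b, hb, hL⟩

end Transport

/-- The finite simple orthogonal groups `Ω₈⁻(q)` (the derived subgroup of the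
orthogonal group of a nondegenerate minus-type quadratic form on `F⁸`, i.e. one
of Witt index 3) are `(2,3)`-generated for every prime power `q ≥ 2`. -/
theorem omega8minus_two_three_generated
    (F : Type*) [Field F] [Fintype F] (q : ℕ) (hq : Fintype.card F = q)
    (Q : QuadraticForm F (Fin 8 → F))
    (hnd : ∀ u : Fin 8 → F, (∀ v : Fin 8 → F, Q (u + v) = Q u + Q v) → u = 0)
    (h3 : ∃ W : Submodule F (Fin 8 → F),
      Module.finrank F W = 3 ∧ ∀ w ∈ W, Q w = 0)
    (h4 : ¬ ∃ W : Submodule F (Fin 8 → F),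
      Module.finrank F W = 4 ∧ ∀ w ∈ W, Q w = 0) :
    IsTwoThreeGenerated ↥(commutator ↥(orthogonalGroupOf F (⇑Q))) := by
  have hnd' : ∀ u, (∀ v, polar Q u v = 0) → u = 0 := fun u hu =>
    hnd u fun v => by rw [map_add_polar, hu, add_zero]
  by_cases h2 : (2 : F) = 0
  · obtain ⟨a, ha, hclosure⟩ := exists_artinSchreier_closure_eq_top h2
    have ha0 : a ≠ 0 := fun h => ha 0 (by rw [h]; ring)
    have hE : ∀ s t : F, a * (s * s) + 1 * (s * t) + a * (t * t) = 0 → s = 0 ∧ t = 0 := by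
      intro s t hst
      have ht : t = 0 := by
        by_contra ht
        refine ha (a * s / t + a) ?_
        field_simp
        linear_combination -hst - a * s * t * h2
      subst ht
      simpa [ha0] using hst
    obtain ⟨L, b, hb, hL⟩ := exists_similar_minusForm hnd' h3 h4 (a := a) (m := 1)
      (by simp [h2]) fun _ _ _ => exists_binary_even h2 ha
    exact isTwoThreeGenerated_of_similar L hb hL (orderOf_involEquiv _ _ _ _) orderOf_cycleEquiv
      (closure_eq_commutator_even h2 ha0 hclosure hE)
  · obtain ⟨d, hd, hclosure⟩ := exists_not_isSquare_closure_eq_top h2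
    obtain ⟨a, rfl⟩ : ∃ a, d = a + 1 := ⟨d - 1, by ring⟩
    have ha1 : a + 1 ≠ 0 := fun h => hd (h ▸ IsSquare.zero)
    have ha0 : a ≠ 0 := fun h => hd ⟨1, by rw [h]; ring⟩
    have ha8 : a - 8 ≠ 0 := fun h => hd ⟨3, by linear_combination h⟩
    have hE : ∀ s t : F, a * (s * s) + (2 * a + 4) * (s * t) + a * (t * t) = 0 →
        s = 0 ∧ t = 0 := by
      intro s t hst
      have hadd : s + t = 0 := by
        by_contra hadd
        refine hd ⟨(s - t) / (s + t), ?_⟩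
        field_simp
        linear_combination hst
      have hs : s = 0 := by
        rw [eq_neg_of_add_eq_zero_right hadd] at hst
        have : 2 * 2 * (s * s) = 0 := by linear_combination -hst
        simpa [h2] using this
      exact ⟨hs, by rwa [hs, zero_add] at hadd⟩
    obtain ⟨L, b, hb, hL⟩ := exists_similar_minusForm hnd' h3 h4 (a := a) (m := 2 * a + 4)
      (by
        rw [show 2 * a * (2 * a) - (2 * a + 4) * (2 * a + 4) = -(2 * 2 * 2 * 2 * (a + 1)) by ring]
        exact neg_ne_zero.2 (by simp [h2, ha1])) fun _ _ _ => exists_binary_odd h2 hd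
    exact isTwoThreeGenerated_of_similar L hb hL (orderOf_involEquiv _ _ _ _) orderOf_cycleEquiv
      (closure_eq_commutator_odd h2 ha0 ha8 ha1 hclosure hE)
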